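/- arXiv:2111.11273 — 2 statements merged into one kernel-verified Lean document; each statement's English description precedes it below -/
import Mathlib

section
/- Suppose Φ is irreducible, reduced, crystallographic and not of type G₂, with Weyl group W. Then w ∈ W is fully commutative if and only if ⟨α,β⟩ ≥ 0 for all α, β in the inversion set Φ(w). -/
/- Background setup: a finite reduced crystallographic root system `Φ` with chosen
positive roots `Φ⁺` in a euclidean space `V`, the Cartan pairing, and the basic
combinatorial notions used in the statement. -/

open scoped RealInnerProductSpace

noncomputable section

variable {V : Type*} [NormedAddCommGroup V] [InnerProductSpace ℝ V]

/-- The Cartan pairing `⟨α, β⟩ = 2 (α, β) / (β, β)`. -/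
def cpair (α β : V) : ℝ := 2 * ⟪α, β⟫ / ⟪β, β⟫

/-- The reflection associated to `β`, as a linear endomorphism of `V`:
`v ↦ v - (2 (β, v)/(β, β)) • β`. -/
def reflEnd (β : V) : Module.End ℝ V :=
  LinearMap.id -
    (LinearMap.toSpanSingleton ℝ V β ∘ₗ ((2 / ⟪β, β⟫) • (innerSL ℝ β).toLinearMap))

/-- A subset of `V` is orthogonal if the Cartan pairing of any two distinct
elements vanishes. -/
def OrthogonalSet (S : Set V) : Prop := ∀ γ ∈ S, ∀ γ' ∈ S, γ ≠ γ' → cpair γ γ' = 0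

/-- A finite reduced crystallographic root system in the euclidean space `V`,
together with a choice of positive roots. -/
structure RootSystemData (V : Type*) [NormedAddCommGroup V] [InnerProductSpace ℝ V] where
  /-- the set of roots Φ -/
  roots : Set V
  /-- the set of positive roots Φ⁺ -/
  pos : Set V
  finite : roots.Finite
  ne_zero : ∀ α ∈ roots, α ≠ 0
  span_eq_top : Submodule.span ℝ roots = ⊤
  reduced : ∀ α ∈ roots, ∀ t : ℝ, t • α ∈ roots → t = 1 ∨ t = -1
  crystallographic : ∀ α ∈ roots, ∀ β ∈ roots, ∃ n : ℤ, cpair α β = (n : ℝ)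
  reflect_mem : ∀ α ∈ roots, ∀ β ∈ roots, reflEnd β α ∈ roots
  pos_subset : pos ⊆ roots
  pos_iff : ∀ α ∈ roots, (α ∈ pos ↔ ¬ (-α ∈ pos))
  pos_add : ∀ α ∈ pos, ∀ β ∈ pos, α + β ∈ roots → α + β ∈ pos

namespace RootSystemData

variable (D : RootSystemData V)

/-- Irreducibility: the roots admit no nontrivial partition into two mutually
orthogonal parts. -/
def IsIrreducible : Prop :=
  D.roots.Nonempty ∧
    ∀ s ⊆ D.roots, (∀ α ∈ s, ∀ β ∈ D.roots \ s, ⟪α, β⟫ = 0) → s = ∅ ∨ s = D.roots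

/-- An irreducible root system is not of type `G₂` iff no Cartan pairing of two
roots equals `±3`. -/
def NotG2 : Prop := ∀ α ∈ D.roots, ∀ β ∈ D.roots, cpair α β ≠ 3 ∧ cpair α β ≠ -3

/-- An irreducible root system is of type `G₂` iff some Cartan pairing of two
roots equals `±3`. -/
def IsG2 : Prop :=
  D.IsIrreducible ∧ ∃ α ∈ D.roots, ∃ β ∈ D.roots, cpair α β = 3 ∨ cpair α β = -3

/-- All roots have the same length (types A, D, E). -/
def SimplyLaced : Prop := ∀ α ∈ D.roots, ∀ β ∈ D.roots, ⟪α, α⟫ = ⟪β, β⟫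

/-- There are exactly two root lengths, with squared-length ratio 2
(types B, C, F₄). -/
def DoublyLaced : Prop :=
  (∃ α ∈ D.roots, ∃ β ∈ D.roots, ⟪β, β⟫ = 2 * ⟪α, α⟫) ∧
    ∀ α ∈ D.roots, ∀ β ∈ D.roots,
      ⟪α, α⟫ = ⟪β, β⟫ ∨ ⟪β, β⟫ = 2 * ⟪α, α⟫ ∨ ⟪α, α⟫ = 2 * ⟪β, β⟫

/-- A root of maximal length. -/
def IsLong (α : V) : Prop := α ∈ D.roots ∧ ∀ β ∈ D.roots, ⟪β, β⟫ ≤ ⟪α, α⟫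

/-- A root of minimal length. -/
def IsShort (α : V) : Prop := α ∈ D.roots ∧ ∀ β ∈ D.roots, ⟪α, α⟫ ≤ ⟪β, β⟫

/-- A set of positive roots is convex if any root which is a linear combination of
two of its elements with positive coefficients lies in it. -/
def ConvexSubset (S : Set V) : Prop :=
  ∀ α ∈ S, ∀ β ∈ S, ∀ a b : ℝ, 0 < a → 0 < b →
    a • α + b • β ∈ D.roots → a • α + b • β ∈ S

/-- A subset `Ψ ⊆ Φ⁺` is biconvex if both `Ψ` and `Φ⁺ \ Ψ` are convex. -/
def Biconvex (S : Set V) : Prop :=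
  S ⊆ D.pos ∧ D.ConvexSubset S ∧ D.ConvexSubset (D.pos \ S)

/-- A subset `Ψ ⊆ Φ⁺` is a combinatorial ideal if `α ∈ Ψ`, `β ∈ Φ⁺`, `α + β ∈ Φ⁺`
imply `α + β ∈ Ψ`. -/
def CombIdeal (S : Set V) : Prop :=
  S ⊆ D.pos ∧ ∀ α ∈ S, ∀ β ∈ D.pos, α + β ∈ D.pos → α + β ∈ S

end RootSystemData

/- The Weyl group: words in the simple reflections, reduced expressions, length,
inversion sets, and the (fully) commutative elements. -/

/-- The product of the reflections attached to a word (a list of roots). -/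
def wordProd (l : List V) : Module.End ℝ V := (l.map reflEnd).prod

/-- The alternating word `[α, β, α, β, ...]` of length `n`. -/
def altWord (α β : V) : ℕ → List V
  | 0 => []
  | n + 1 => α :: altWord β α n

namespace RootSystemData

variable (D : RootSystemData V)

/-- The simple roots: the positive roots which are not sums of two positive
roots. -/
def simpleRoots : Set V :=
  {α | α ∈ D.pos ∧ ¬ ∃ β ∈ D.pos, ∃ γ ∈ D.pos, α = β + γ}

/-- A word in the simple reflections, encoded as a list of simple roots. -/
def IsWord (l : List V) : Prop := ∀ α ∈ l, α ∈ D.simpleRoots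

/-- Membership in the Weyl group: `w` is a product of simple reflections. -/
def InWeyl (w : Module.End ℝ V) : Prop := ∃ l : List V, D.IsWord l ∧ wordProd l = w

/-- A reduced word: a word of minimal length among all words with the same
product. -/
def IsReducedWord (l : List V) : Prop :=
  D.IsWord l ∧
    ∀ l' : List V, D.IsWord l' → wordProd l' = wordProd l → l.length ≤ l'.length

/-- The length of a Weyl group element. -/
noncomputable def len (w : Module.End ℝ V) : ℕ :=
  sInf {n | ∃ l : List V, D.IsWord l ∧ wordProd l = w ∧ l.length = n}

/-- The inversion set `Φ(w) = {α ∈ Φ⁺ | w(α) ∈ Φ⁻}`. -/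
def inversions (w : Module.End ℝ V) : Set V :=
  {α | α ∈ D.pos ∧ w α ∈ D.roots ∧ w α ∉ D.pos}

/-- `w` is fully commutative: no reduced expression for `w` contains a contiguous
substring `s_α s_β s_α s_β ⋯` of length `m(s_α, s_β)`, where `s_α, s_β` are
non-commuting simple reflections and `m(s_α, s_β)` is the order of `s_α s_β`. -/
def FullyCommutative (w : Module.End ℝ V) : Prop :=
  D.InWeyl w ∧
    ∀ l : List V, D.IsReducedWord l → wordProd l = w →
      ∀ α ∈ D.simpleRoots, ∀ β ∈ D.simpleRoots,
        ¬ Commute (reflEnd α) (reflEnd β) →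
          ¬ (altWord α β (orderOf (reflEnd α * reflEnd β)) <:+: l)

/-- `w` is commutative: no reduced expression for `w` contains a substring
`s_α s_β s_α` with `α, β` simple and `‖α‖ ≤ ‖β‖`. -/
def Commutative (w : Module.End ℝ V) : Prop :=
  D.InWeyl w ∧
    ∀ l : List V, D.IsReducedWord l → wordProd l = w →
      ∀ α ∈ D.simpleRoots, ∀ β ∈ D.simpleRoots, ‖α‖ ≤ ‖β‖ →
        ¬ ([α, β, α] <:+: l)

end RootSystemData

set_option linter.unusedSimpArgs false

open RootSystemData

section Basics

variable {V : Type*} [NormedAddCommGroup V] [InnerProductSpace ℝ V]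

lemma refl_apply (β v : V) : reflEnd β v = v - (2 * ⟪β, v⟫ / ⟪β, β⟫) • β := by
  simp only [reflEnd, LinearMap.sub_apply, LinearMap.id_apply, LinearMap.comp_apply,
    LinearMap.toSpanSingleton_apply, LinearMap.smul_apply, ContinuousLinearMap.coe_coe,
    innerSL_apply_apply, smul_eq_mul]
  congr 2
  ring

lemma refl_eq {β v : V} (hβ : β ≠ 0) {t : ℝ} (h : 2 * ⟪β, v⟫ = t * ⟪β, β⟫) :
    reflEnd β v = v - t • β := by
  have h0 : ⟪β, β⟫ ≠ 0 := inner_self_ne_zero.mpr hβ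
  rw [refl_apply, h, mul_div_assoc, div_self h0, mul_one]

lemma refl_self {β : V} (hβ : β ≠ 0) : reflEnd β β = -β := by
  rw [refl_eq hβ (t := 2) rfl]
  module

lemma refl_orth {β v : V} (h : ⟪β, v⟫ = 0) : reflEnd β v = v := by
  rw [refl_apply, h]; simp

lemma inner_refl {β : V} (hβ : β ≠ 0) (u v : V) :
    ⟪reflEnd β u, reflEnd β v⟫ = ⟪u, v⟫ := by
  have h0 : ⟪β, β⟫ ≠ 0 := inner_self_ne_zero.mpr hβ
  rw [refl_apply, refl_apply]
  simp only [inner_sub_left, inner_sub_right, real_inner_smul_left, real_inner_smul_right]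
  rw [real_inner_comm β u]
  field_simp
  ring

lemma refl_refl {β : V} (hβ : β ≠ 0) (v : V) : reflEnd β (reflEnd β v) = v := by
  have h0 : ⟪β, β⟫ ≠ 0 := inner_self_ne_zero.mpr hβ
  rw [refl_apply β v, map_sub, map_smul, refl_self hβ, refl_apply]
  module

lemma refl_mul_self {β : V} (hβ : β ≠ 0) : reflEnd β * reflEnd β = 1 := by
  ext v
  simp [refl_refl hβ]

lemma inner_refl_left {β : V} (hβ : β ≠ 0) (u v : V) :
    ⟪reflEnd β u, v⟫ = ⟪u, reflEnd β v⟫ := by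
  rw [← inner_refl hβ u, refl_refl hβ]

lemma wordProd_nil : wordProd ([] : List V) = 1 := rfl

lemma wordProd_cons (a : V) (l : List V) : wordProd (a :: l) = reflEnd a * wordProd l := by
  simp [wordProd]

lemma wordProd_append (l l' : List V) : wordProd (l ++ l') = wordProd l * wordProd l' := by
  simp [wordProd]

lemma wordProd_single (a : V) : wordProd [a] = reflEnd a := by
  simp [wordProd]

end Basics

namespace RootSystemData

variable {V : Type*} [NormedAddCommGroup V] [InnerProductSpace ℝ V] (D : RootSystemData V)

lemma ne0 {γ : V} (h : γ ∈ D.roots) : γ ≠ 0 := D.ne_zero γ h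

lemma inner_pos {γ : V} (h : γ ∈ D.roots) : 0 < ⟪γ, γ⟫ :=
  real_inner_self_pos.mpr (D.ne0 h)

lemma neg_root {γ : V} (h : γ ∈ D.roots) : -γ ∈ D.roots := by
  have := D.reflect_mem γ h γ h
  rwa [refl_self (D.ne0 h)] at this

lemma neg_pos_of_not {γ : V} (h : γ ∈ D.roots) (h' : γ ∉ D.pos) : -γ ∈ D.pos := by
  by_contra h2
  exact h' ((D.pos_iff γ h).mpr h2)

lemma not_pos_of_neg {γ : V} (h : -γ ∈ D.pos) : γ ∉ D.pos := by
  intro h'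
  exact (D.pos_iff γ (D.pos_subset h')).mp h' h

/-- Two roots of positive inner product, not equal: the three possibilities (no `G₂`). -/
lemma tri (hG : D.NotG2) {γ δ : V} (hγ : γ ∈ D.roots) (hδ : δ ∈ D.roots) (hne : γ ≠ δ)
    (hp : 0 < ⟪γ, δ⟫) :
    (⟪γ, γ⟫ = ⟪δ, δ⟫ ∧ 2 * ⟪γ, δ⟫ = ⟪δ, δ⟫) ∨ (⟪γ, γ⟫ = 2 * ⟪δ, δ⟫ ∧ ⟪γ, δ⟫ = ⟪δ, δ⟫) ∨
      (⟪δ, δ⟫ = 2 * ⟪γ, γ⟫ ∧ ⟪γ, δ⟫ = ⟪γ, γ⟫) := by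
  obtain ⟨n, hn⟩ := D.crystallographic γ hγ δ hδ
  obtain ⟨m, hm⟩ := D.crystallographic δ hδ γ hγ
  have h3 := (hG γ hγ δ hδ).1
  have h4 := (hG δ hδ γ hγ).1
  rw [hn] at h3
  rw [hm] at h4
  have hg := D.inner_pos hγ
  have hd := D.inner_pos hδ
  simp only [cpair] at hn hm
  rw [real_inner_comm] at hm
  rw [div_eq_iff hd.ne'] at hn
  rw [div_eq_iff hg.ne'] at hm
  have hn0 : 0 < n := by
    by_contra hc
    have : (n : ℝ) ≤ 0 := by exact_mod_cast not_lt.mp hc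
    nlinarith
  have hm0 : 0 < m := by
    by_contra hc
    have : (m : ℝ) ≤ 0 := by exact_mod_cast not_lt.mp hc
    nlinarith
  have hcs : ⟪γ, δ⟫ * ⟪γ, δ⟫ < ⟪γ, γ⟫ * ⟪δ, δ⟫ := by
    refine lt_of_le_of_ne (real_inner_mul_inner_self_le γ δ) ?_
    intro he
    have h0 : ⟪δ - (⟪γ, δ⟫ / ⟪γ, γ⟫) • γ, δ - (⟪γ, δ⟫ / ⟪γ, γ⟫) • γ⟫ = 0 := by
      simp only [inner_sub_left, inner_sub_right, real_inner_smul_left, real_inner_smul_right]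
      rw [real_inner_comm γ δ]
      field_simp
      nlinarith
    have h1 := sub_eq_zero.mp (inner_self_eq_zero.mp h0)
    rcases D.reduced γ hγ _ (h1 ▸ hδ) with h | h
    · rw [h, one_smul] at h1
      exact hne h1.symm
    · have : 0 < ⟪γ, δ⟫ / ⟪γ, γ⟫ := by positivity
      linarith
  have hnm : n * m < 4 := by
    have : (n * m : ℝ) < 4 := by
      by_contra hc
      have h5 : 4 * (⟪γ, δ⟫ * ⟪γ, δ⟫) = (n * m) * (⟪γ, γ⟫ * ⟪δ, δ⟫) := by
        linear_combination 2 * ⟪γ, δ⟫ * hn + n * ⟪δ, δ⟫ * hm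
      have : 0 < ⟪γ, γ⟫ * ⟪δ, δ⟫ := by positivity
      nlinarith
    exact_mod_cast this
  have hn4 : n < 4 := by nlinarith
  have hm4 : m < 4 := by nlinarith
  have h3' : n ≠ 3 := by rintro rfl; simp at h3
  have h4' : m ≠ 3 := by rintro rfl; simp at h4
  have hnn : n = 1 ∨ n = 2 := by omega
  have hmm : m = 1 ∨ m = 2 := by omega
  rcases hnn with rfl | rfl <;> rcases hmm with rfl | rfl
  · left; push_cast at *; constructor <;> linarith
  · right; right; push_cast at *; constructor <;> linarith
  · right; left; push_cast at *; constructor <;> linarith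
  · omega

lemma tri_neg (hG : D.NotG2) {γ δ : V} (hγ : γ ∈ D.roots) (hδ : δ ∈ D.roots) (hne : γ ≠ -δ)
    (hp : ⟪γ, δ⟫ < 0) :
    (⟪γ, γ⟫ = ⟪δ, δ⟫ ∧ -2 * ⟪γ, δ⟫ = ⟪δ, δ⟫) ∨ (⟪γ, γ⟫ = 2 * ⟪δ, δ⟫ ∧ -⟪γ, δ⟫ = ⟪δ, δ⟫) ∨
      (⟪δ, δ⟫ = 2 * ⟪γ, γ⟫ ∧ -⟪γ, δ⟫ = ⟪γ, γ⟫) := by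
  have := D.tri hG hγ (D.neg_root hδ) hne (by rw [inner_neg_right]; linarith)
  simp only [inner_neg_right, inner_neg_left, neg_neg] at this
  rcases this with h | h | h
  · left; refine ⟨h.1, by linarith [h.2]⟩
  · right; left; exact h
  · right; right; exact h

lemma sub_root (hG : D.NotG2) {γ δ : V} (hγ : γ ∈ D.roots) (hδ : δ ∈ D.roots) (hne : γ ≠ δ)
    (hp : 0 < ⟪γ, δ⟫) : γ - δ ∈ D.roots := by
  rcases D.tri hG hγ hδ hne hp with h | h | h
  · have := D.reflect_mem γ hγ δ hδ
    rwa [refl_eq (D.ne0 hδ) (t := 1) (by rw [real_inner_comm]; linarith [h.2]), one_smul] at this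
  · have := D.neg_root (D.reflect_mem δ hδ γ hγ)
    rwa [refl_eq (D.ne0 hγ) (t := 1) (by linarith [h.1, h.2]), one_smul, neg_sub] at this
  · have := D.reflect_mem γ hγ δ hδ
    rwa [refl_eq (D.ne0 hδ) (t := 1) (by rw [real_inner_comm]; linarith [h.1, h.2]), one_smul]
      at this

lemma add_root (hG : D.NotG2) {γ δ : V} (hγ : γ ∈ D.roots) (hδ : δ ∈ D.roots) (hne : γ ≠ -δ)
    (hp : ⟪γ, δ⟫ < 0) : γ + δ ∈ D.roots := by
  have := D.sub_root hG hγ (D.neg_root hδ) hne (by rw [inner_neg_right]; linarith)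
  rwa [sub_neg_eq_add] at this

lemma sum_ne_zero (hG : D.NotG2) : ∀ n : ℕ, ∀ s : Multiset V, s.card = n + 1 →
    (∀ γ ∈ s, γ ∈ D.pos) → s.sum ≠ 0 := by
  intro n
  induction n with
  | zero =>
    intro s hs h h0
    obtain ⟨a, rfl⟩ := Multiset.card_eq_one.mp hs
    simp at h0
    exact D.ne0 (D.pos_subset (h a (by simp))) h0
  | succ n ih =>
    intro s hs h h0
    obtain ⟨a, has⟩ := Multiset.card_pos_iff_exists_mem.mp (by omega : 0 < s.card)
    obtain ⟨t, rfl⟩ := Multiset.exists_cons_of_mem has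
    have ha := h a (by simp)
    have : ∃ b ∈ t, ⟪a, b⟫ < 0 := by
      by_contra hc
      push Not at hc
      have h1 : 0 ≤ ⟪a, t.sum⟫ := by
        have : ∀ t : Multiset V, (∀ b ∈ t, 0 ≤ ⟪a, b⟫) → 0 ≤ ⟪a, t.sum⟫ := by
          intro t
          induction t using Multiset.induction with
          | empty => simp
          | cons b t iht =>
            intro hb
            rw [Multiset.sum_cons, inner_add_right]
            have := hb b (by simp)
            have := iht (fun c hc => hb c (by simp [hc]))
            linarith
        exact this t hc
      rw [Multiset.sum_cons] at h0
      have h2 : t.sum = -a := by rw [eq_neg_iff_add_eq_zero, add_comm]; exact h0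
      rw [h2, inner_neg_right] at h1
      linarith [D.inner_pos (D.pos_subset ha)]
    obtain ⟨b, hb, hab⟩ := this
    obtain ⟨t', rfl⟩ := Multiset.exists_cons_of_mem hb
    have hb' := h b (by simp)
    have hab' : a + b ∈ D.pos := by
      refine D.pos_add a ha b hb' (D.add_root hG (D.pos_subset ha) (D.pos_subset hb') ?_ hab)
      rintro rfl
      exact D.not_pos_of_neg ha hb'
    refine ih ((a + b) ::ₘ t') ?_ ?_ ?_
    · simp at hs ⊢; omega
    · intro γ hγ
      rcases Multiset.mem_cons.mp hγ with rfl | hγ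
      · exact hab'
      · exact h γ (by simp [hγ])
    · rw [← h0]; simp [add_assoc]

/-- The monoid generated by positive roots. -/
def posMon : AddSubmonoid V := AddSubmonoid.closure D.pos

lemma mem_posMon {γ : V} (h : γ ∈ D.pos) : γ ∈ D.posMon := AddSubmonoid.subset_closure h

lemma pos_of_posMon (hG : D.NotG2) {γ : V} (h : γ ∈ D.roots) (hM : γ ∈ D.posMon) :
    γ ∈ D.pos := by
  by_contra hc
  have hn := D.neg_pos_of_not h hc
  obtain ⟨s, hs, rfl⟩ := AddSubmonoid.exists_multiset_of_mem_closure hM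
  refine D.sum_ne_zero hG s.card ((-s.sum) ::ₘ s) (by simp) ?_ (by simp)
  intro γ hγ
  rcases Multiset.mem_cons.mp hγ with rfl | hγ
  · exact hn
  · exact hs γ hγ

lemma pos_mem_simple (hG : D.NotG2) : ∀ n : ℕ, ∀ γ ∈ D.pos,
    {μ | μ ∈ D.pos ∧ γ - μ ∈ D.posMon}.ncard = n →
    γ ∈ AddSubmonoid.closure D.simpleRoots := by
  intro n
  induction n using Nat.strong_induction_on with
  | _ n ih =>
    intro γ hγ hn
    by_cases hs : γ ∈ D.simpleRoots
    · exact AddSubmonoid.subset_closure hs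
    · have : ∃ β ∈ D.pos, ∃ μ ∈ D.pos, γ = β + μ := by
        by_contra hc; exact hs ⟨hγ, hc⟩
      obtain ⟨β, hβ, μ, hμ, rfl⟩ := this
      have key : ∀ β ∈ D.pos, ∀ μ ∈ D.pos, β + μ ∈ D.pos →
          {ν | ν ∈ D.pos ∧ β - ν ∈ D.posMon}.ncard <
          {ν | ν ∈ D.pos ∧ β + μ - ν ∈ D.posMon}.ncard := by
        intro β hβ μ hμ hγ
        refine Set.ncard_lt_ncard ?_ ((D.finite.subset D.pos_subset).subset (fun ν h => h.1))
        refine ⟨fun ν h => ⟨h.1, ?_⟩, fun h => ?_⟩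
        · have := D.posMon.add_mem h.2 (D.mem_posMon hμ)
          convert this using 1
          abel
        · have h1 := (h (show β + μ ∈ _ from ⟨hγ, by simp⟩)).2
          have h2 : -μ ∈ D.posMon := by convert h1 using 1; abel
          have h3 := D.pos_of_posMon hG (D.neg_root (D.pos_subset hμ)) h2
          exact D.not_pos_of_neg h3 hμ
      refine AddSubmonoid.add_mem _ (ih _ ?_ β hβ rfl) (ih _ ?_ μ hμ rfl)
      · rw [← hn]; exact key β hβ μ hμ hγ
      · rw [← hn]
        have := key μ hμ β hβ (by rwa [add_comm])
        rwa [add_comm μ β] at this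

lemma simple_pos {a : V} (h : a ∈ D.simpleRoots) : a ∈ D.pos := h.1

lemma simple_root {a : V} (h : a ∈ D.simpleRoots) : a ∈ D.roots := D.pos_subset h.1

lemma simple_sub_not {a γ : V} (h : a ∈ D.simpleRoots) (hγ : γ ∈ D.pos) : a - γ ∉ D.pos := by
  intro h'
  exact h.2 ⟨_, h', γ, hγ, by abel⟩

lemma simple_inner (hG : D.NotG2) {a b : V} (ha : a ∈ D.simpleRoots) (hb : b ∈ D.simpleRoots)
    (hne : a ≠ b) : ⟪a, b⟫ ≤ 0 := by
  by_contra hc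
  have h := D.sub_root hG (D.simple_root ha) (D.simple_root hb) hne (not_le.mp hc)
  have h1 := D.simple_sub_not ha (D.simple_pos hb)
  have h2 := D.simple_sub_not hb (D.simple_pos ha)
  have h3 := D.neg_pos_of_not h h1
  rw [neg_sub] at h3
  exact h2 h3

lemma sub_simple_pos (hG : D.NotG2) {a γ : V} (ha : a ∈ D.simpleRoots) (hγ : γ ∈ D.pos)
    (hne : γ ≠ a) (hp : 0 < ⟪γ, a⟫) : γ - a ∈ D.pos := by
  have h := D.sub_root hG (D.pos_subset hγ) (D.simple_root ha) hne hp
  by_contra h1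
  have h3 := D.neg_pos_of_not h h1
  rw [neg_sub] at h3
  exact D.simple_sub_not ha hγ h3

lemma pos_not_opp {a b : V} (ha : a ∈ D.pos) (hb : b ∈ D.pos) {t : ℝ} (ht : 0 < t) :
    b ≠ -(t • a) := by
  intro h
  rw [← neg_smul] at h
  rcases D.reduced a (D.pos_subset ha) (-t) (h ▸ D.pos_subset hb) with h1 | h1
  · linarith
  · rw [h1] at h
    rw [neg_one_smul] at h
    subst h
    exact D.not_pos_of_neg hb ha

/-- A simple reflection permutes the other positive roots. -/
lemma refl_pos (hG : D.NotG2) {a γ : V} (ha : a ∈ D.simpleRoots) (hγ : γ ∈ D.pos)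
    (hne : γ ≠ a) : reflEnd a γ ∈ D.pos := by
  have ha0 := D.ne0 (D.simple_root ha)
  have hr := D.reflect_mem γ (D.pos_subset hγ) a (D.simple_root ha)
  have hM := D.mem_posMon hγ
  have hMa := D.mem_posMon (D.simple_pos ha)
  rcases lt_trichotomy ⟪γ, a⟫ 0 with h | h | h
  · apply D.pos_of_posMon hG hr
    have hne' : γ ≠ -a := by
      rintro rfl; exact D.not_pos_of_neg hγ (D.simple_pos ha)
    rcases D.tri_neg hG (D.pos_subset hγ) (D.simple_root ha) hne' h with h | h | h
    · rw [refl_eq ha0 (t := -1) (by rw [real_inner_comm]; linarith [h.2])]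
      convert D.posMon.add_mem hM hMa using 1
      module
    · rw [refl_eq ha0 (t := -2) (by rw [real_inner_comm]; linarith [h.2])]
      convert D.posMon.add_mem (D.posMon.add_mem hM hMa) hMa using 1
      module
    · rw [refl_eq ha0 (t := -1) (by rw [real_inner_comm]; linarith [h.2, h.1])]
      convert D.posMon.add_mem hM hMa using 1
      module
  · rwa [refl_orth (by rwa [real_inner_comm])]
  · have h1 := D.sub_simple_pos hG ha hγ hne h
    rcases D.tri hG (D.pos_subset hγ) (D.simple_root ha) hne h with h | h | h
    · rwa [refl_eq ha0 (t := 1) (by rw [real_inner_comm]; linarith [h.2]), one_smul]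
    · rw [refl_eq ha0 (t := 2) (by rw [real_inner_comm]; linarith [h.2])] at hr ⊢
      by_contra hc
      have h3 := D.neg_pos_of_not hr hc
      refine ha.2 ⟨_, h3, _, h1, ?_⟩
      module
    · rwa [refl_eq ha0 (t := 1) (by rw [real_inner_comm]; linarith [h.2, h.1]), one_smul]

/-! Weyl group elements -/

variable {D}

lemma InWeyl.one : D.InWeyl 1 := ⟨[], by simp [IsWord], rfl⟩

lemma InWeyl.mul {u v : Module.End ℝ V} (hu : D.InWeyl u) (hv : D.InWeyl v) :
    D.InWeyl (u * v) := by
  obtain ⟨l, hl, rfl⟩ := hu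
  obtain ⟨l', hl', rfl⟩ := hv
  refine ⟨l ++ l', ?_, wordProd_append l l'⟩
  intro a ha
  rcases List.mem_append.mp ha with h | h
  · exact hl a h
  · exact hl' a h

lemma InWeyl.refl {a : V} (ha : a ∈ D.simpleRoots) : D.InWeyl (reflEnd a) :=
  ⟨[a], by simpa [IsWord] using ha, wordProd_single a⟩

lemma IsWord.props {l : List V} (hl : D.IsWord l) :
    (∀ γ ∈ D.roots, wordProd l γ ∈ D.roots) ∧ (∀ u v, ⟪wordProd l u, wordProd l v⟫ = ⟪u, v⟫) ∧
    wordProd l * wordProd l.reverse = 1 := by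
  induction l with
  | nil => simp [wordProd]
  | cons a l ih =>
    have ha : a ∈ D.simpleRoots := hl a (by simp)
    have ha0 := D.ne0 (D.simple_root ha)
    obtain ⟨h1, h2, h3⟩ := ih (fun b hb => hl b (by simp [hb]))
    refine ⟨fun γ hγ => ?_, fun u v => ?_, ?_⟩
    · rw [wordProd_cons]
      exact D.reflect_mem _ (h1 γ hγ) a (D.simple_root ha)
    · rw [wordProd_cons, Module.End.mul_apply, Module.End.mul_apply, inner_refl ha0, h2]
    · rw [List.reverse_cons, wordProd_cons, wordProd_append, wordProd_single, mul_assoc,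
        ← mul_assoc (wordProd l), h3, one_mul, refl_mul_self ha0]

lemma IsWord.reverse {l : List V} (hl : D.IsWord l) : D.IsWord l.reverse :=
  fun a ha => hl a (by simpa using ha)

lemma IsWord.append {l l' : List V} (hl : D.IsWord l) (hl' : D.IsWord l') :
    D.IsWord (l ++ l') := by
  intro a ha
  rcases List.mem_append.mp ha with h | h
  · exact hl a h
  · exact hl' a h

lemma IsWord.single {a : V} (ha : a ∈ D.simpleRoots) : D.IsWord [a] := by
  simpa [IsWord] using ha

lemma InWeyl.root {w : Module.End ℝ V} (hw : D.InWeyl w) {γ : V} (h : γ ∈ D.roots) :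
    w γ ∈ D.roots := by
  obtain ⟨l, hl, rfl⟩ := hw
  exact hl.props.1 γ h

lemma InWeyl.inner {w : Module.End ℝ V} (hw : D.InWeyl w) (u v : V) :
    ⟪w u, w v⟫ = ⟪u, v⟫ := by
  obtain ⟨l, hl, rfl⟩ := hw
  exact hl.props.2.1 u v

lemma InWeyl.inj {w : Module.End ℝ V} (hw : D.InWeyl w) {u v : V} (h : w u = w v) : u = v := by
  rw [← sub_eq_zero, ← inner_self_eq_zero (𝕜 := ℝ), ← hw.inner, map_sub, h]
  simp

lemma mem_inv {w : Module.End ℝ V} (hw : D.InWeyl w) {γ : V} :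
    γ ∈ D.inversions w ↔ γ ∈ D.pos ∧ w γ ∉ D.pos := by
  constructor
  · exact fun h => ⟨h.1, h.2.2⟩
  · exact fun h => ⟨h.1, hw.root (D.pos_subset h.1), h.2⟩

lemma exists_simple (hG : D.NotG2) {w : Module.End ℝ V} (hw : D.InWeyl w) {γ : V}
    (h : γ ∈ D.inversions w) : ∃ a ∈ D.simpleRoots, a ∈ D.inversions w := by
  by_contra hc
  push Not at hc
  have h1 : ∀ a ∈ D.simpleRoots, w a ∈ D.pos := by
    intro a ha
    by_contra h2
    exact hc a ha ((mem_inv hw).mpr ⟨ha.1, h2⟩)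
  have h2 : ∀ v ∈ AddSubmonoid.closure D.simpleRoots, w v ∈ D.posMon := by
    intro v hv
    induction hv using AddSubmonoid.closure_induction with
    | mem x hx => exact D.mem_posMon (h1 x hx)
    | zero => simp [D.posMon.zero_mem]
    | add x y _ _ hx hy => rw [map_add]; exact D.posMon.add_mem hx hy
  exact h.2.2 (D.pos_of_posMon hG h.2.1 (h2 γ (D.pos_mem_simple hG _ γ h.1 rfl)))

lemma exchange (hG : D.NotG2) {a : V} (ha : a ∈ D.simpleRoots) : ∀ l : List V, D.IsWord l →
    wordProd l a ∉ D.pos → ∃ l', D.IsWord l' ∧ l'.length + 1 = l.length ∧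
      wordProd l' = wordProd l * reflEnd a := by
  intro l
  induction l with
  | nil =>
    intro _ h
    exact absurd (D.simple_pos ha) h
  | cons b l ih =>
    intro hl h
    have hb : b ∈ D.simpleRoots := hl b (by simp)
    have hl' : D.IsWord l := fun c hc => hl c (by simp [hc])
    by_cases h1 : wordProd l a ∈ D.pos
    · have h2 : wordProd l a = b := by
        by_contra hne
        apply h
        rw [wordProd_cons]
        exact D.refl_pos hG hb h1 hne
      refine ⟨l, hl', rfl, ?_⟩
      ext v
      rw [wordProd_cons, Module.End.mul_apply, Module.End.mul_apply]
      have hp := hl'.props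
      rw [refl_apply a v, map_sub, map_smul, h2, refl_apply b]
      have h3 : ⟪b, b⟫ = ⟪a, a⟫ := by rw [← h2, hp.2.1]
      have h4 : ⟪b, wordProd l v⟫ = ⟪a, v⟫ := by rw [← h2, hp.2.1]
      have h5 : ⟪b, b⟫ ≠ 0 := (D.inner_pos (D.simple_root hb)).ne'
      rw [inner_sub_right, h4, real_inner_smul_right, ← h3]
      have h6 : 2 * (⟪a, v⟫ - 2 * ⟪a, v⟫ / ⟪b, b⟫ * ⟪b, b⟫) / ⟪b, b⟫ =
        - (2 * ⟪a, v⟫ / ⟪b, b⟫) := by field_simp; ring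
      rw [h6]
      module
    · obtain ⟨l', h2, h3, h4⟩ := ih hl' h1
      refine ⟨b :: l', ?_, by simp [h3], by rw [wordProd_cons, h4, wordProd_cons, mul_assoc]⟩
      intro c hc
      rcases List.mem_cons.mp hc with rfl | hc
      · exact hb
      · exact h2 c hc

lemma exists_reduced {w : Module.End ℝ V} (hw : D.InWeyl w) :
    ∃ l, D.IsReducedWord l ∧ wordProd l = w := by
  classical
  have hex : ∃ n, ∃ l, D.IsWord l ∧ wordProd l = w ∧ l.length = n := by
    obtain ⟨l, hl, h⟩ := hw
    exact ⟨_, l, hl, h, rfl⟩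
  obtain ⟨l, hl, h, hn⟩ := Nat.find_spec hex
  refine ⟨l, ⟨hl, fun l' hl' h' => ?_⟩, h⟩
  rw [hn]
  exact Nat.find_min' hex ⟨l', hl', h'.trans h, rfl⟩

lemma reduced_left {l l' : List V} (h : D.IsReducedWord (l ++ l')) : D.IsReducedWord l := by
  have hl : D.IsWord l := fun a ha => h.1 a (by simp [ha])
  have hl' : D.IsWord l' := fun a ha => h.1 a (by simp [ha])
  refine ⟨hl, fun m hm he => ?_⟩
  have := h.2 (m ++ l') (hm.append hl') (by rw [wordProd_append, wordProd_append, he])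
  simpa using this

lemma reduced_right {l l' : List V} (h : D.IsReducedWord (l ++ l')) : D.IsReducedWord l' := by
  have hl : D.IsWord l := fun a ha => h.1 a (by simp [ha])
  have hl' : D.IsWord l' := fun a ha => h.1 a (by simp [ha])
  refine ⟨hl', fun m hm he => ?_⟩
  have := h.2 (l ++ m) (hl.append hm) (by rw [wordProd_append, wordProd_append, he])
  simpa using this

lemma reduced_reverse {l : List V} (h : D.IsReducedWord l) : D.IsReducedWord l.reverse := by
  refine ⟨h.1.reverse, fun m hm he => ?_⟩
  have h1 := h.2 m.reverse hm.reverse ?_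
  · simpa using h1
  · have h2 := hm.reverse.props.2.2
    rw [List.reverse_reverse, he] at h2
    have h3 := h.1.reverse.props.2.2
    rw [List.reverse_reverse] at h3
    calc wordProd m.reverse = wordProd m.reverse * (wordProd l.reverse * wordProd l) := by
          rw [h3, mul_one]
      _ = wordProd l := by rw [← mul_assoc, h2, one_mul]

lemma reduced_snoc_pos (hG : D.NotG2) {l : List V} {a : V} (h : D.IsReducedWord (l ++ [a])) :
    wordProd l a ∈ D.pos := by
  by_contra hc
  have ha : a ∈ D.simpleRoots := h.1 a (by simp)
  obtain ⟨l', h1, h2, h3⟩ := exchange hG ha l (reduced_left h).1 hc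
  have := h.2 l' h1 (by rw [h3, wordProd_append, wordProd_single])
  simp at this
  omega

lemma reduced_snoc (hG : D.NotG2) {l : List V} {a : V} (ha : a ∈ D.simpleRoots)
    {w : Module.End ℝ V} (hw : w a ∉ D.pos)
    (h : D.IsReducedWord l) (hl : wordProd l = w * reflEnd a) :
    D.IsReducedWord (l ++ [a]) ∧ wordProd (l ++ [a]) = w := by
  have h0 : wordProd (l ++ [a]) = w := by
    rw [wordProd_append, wordProd_single, hl, mul_assoc, refl_mul_self (D.ne0 (D.simple_root ha)),
      mul_one]
  refine ⟨⟨h.1.append (IsWord.single ha), fun m hm he => ?_⟩, h0⟩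
  rw [h0] at he
  obtain ⟨l', h1, h2, h3⟩ := exchange hG ha m hm (by rwa [he])
  have := h.2 l' h1 (by rw [h3, he, hl])
  simp
  omega

lemma reduced_mid_inv (hG : D.NotG2) {l l' : List V} {a : V}
    (h : D.IsReducedWord (l ++ a :: l')) :
    wordProd l'.reverse a ∈ D.inversions (wordProd (l ++ a :: l')) := by
  have ha : a ∈ D.simpleRoots := h.1 a (by simp)
  have h1 : D.IsReducedWord (l'.reverse ++ [a]) := by
    have := reduced_reverse (reduced_right h)
    simpa using this
  have h2 : D.IsReducedWord (l ++ [a]) := by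
    apply reduced_left (l' := l')
    simpa using h
  have hl' : D.IsWord l' := fun c hc => h.1 c (by simp [hc])
  rw [mem_inv ⟨_, h.1, rfl⟩]
  refine ⟨reduced_snoc_pos hG h1, ?_⟩
  rw [wordProd_append, wordProd_cons]
  have h3 := congrArg (fun f => f a) hl'.props.2.2
  simp only [Module.End.mul_apply, Module.End.one_apply] at h3 ⊢
  rw [h3, refl_self (D.ne0 (D.simple_root ha)), map_neg]
  apply D.not_pos_of_neg
  rw [neg_neg]
  exact reduced_snoc_pos hG h2

end RootSystemData

namespace RootSystemData

variable {V : Type*} [NormedAddCommGroup V] [InnerProductSpace ℝ V] {D : RootSystemData V}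

lemma rank_two (hG : D.NotG2) {a b : V} (ha : a ∈ D.pos) (hb : b ∈ D.pos)
    (hab : ⟪a, b⟫ < 0) :
    (reflEnd a b = b + a ∧ reflEnd b a = a + b) ∨
    (reflEnd a b = b + a ∧ reflEnd b a = a + (2 : ℝ) • b) ∨
    (reflEnd a b = b + (2 : ℝ) • a ∧ reflEnd b a = a + b) := by
  have hra := D.pos_subset ha
  have hrb := D.pos_subset hb
  have hne : a ≠ -b := by rintro rfl; exact D.not_pos_of_neg ha hb
  rcases D.tri_neg hG hra hrb hne hab with h | h | h
  · left
    rw [refl_eq (D.ne0 hra) (t := -1) (by linarith [h.1, h.2]),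
      refl_eq (D.ne0 hrb) (t := -1) (by rw [real_inner_comm]; linarith [h.1, h.2])]
    constructor <;> module
  · right; left
    rw [refl_eq (D.ne0 hra) (t := -1) (by linarith [h.1, h.2]),
      refl_eq (D.ne0 hrb) (t := -2) (by rw [real_inner_comm]; linarith [h.1, h.2])]
    constructor <;> module
  · right; right
    rw [refl_eq (D.ne0 hra) (t := -2) (by linarith [h.1, h.2]),
      refl_eq (D.ne0 hrb) (t := -1) (by rw [real_inner_comm]; linarith [h.1, h.2])]
    constructor <;> module

lemma braid3 {a b : V} (ha : a ≠ 0) (hb : b ≠ 0) (h1 : reflEnd a b = b + a)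
    (h2 : reflEnd b a = a + b) :
    reflEnd a * (reflEnd b * reflEnd a) = reflEnd b * (reflEnd a * reflEnd b) := by
  ext v
  obtain ⟨f, hf⟩ : ∃ f : ℝ, reflEnd a v = v - f • a := ⟨_, refl_apply a v⟩
  obtain ⟨g, hg⟩ : ∃ g : ℝ, reflEnd b v = v - g • b := ⟨_, refl_apply b v⟩
  simp only [Module.End.mul_apply, map_sub, map_smul, map_add, map_neg, hf, hg, h1, h2,
    refl_self ha, refl_self hb]
  module

lemma braid4 {a b : V} (ha : a ≠ 0) (hb : b ≠ 0) (h1 : reflEnd a b = b + a)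
    (h2 : reflEnd b a = a + (2 : ℝ) • b) :
    reflEnd a * (reflEnd b * (reflEnd a * reflEnd b)) =
      reflEnd b * (reflEnd a * (reflEnd b * reflEnd a)) := by
  ext v
  obtain ⟨f, hf⟩ : ∃ f : ℝ, reflEnd a v = v - f • a := ⟨_, refl_apply a v⟩
  obtain ⟨g, hg⟩ : ∃ g : ℝ, reflEnd b v = v - g • b := ⟨_, refl_apply b v⟩
  simp only [Module.End.mul_apply, map_sub, map_smul, map_add, map_neg, hf, hg, h1, h2,
    refl_self ha, refl_self hb]
  module

lemma order3 {M : Type*} [Monoid M] {s t : M} (hs : s * s = 1) (ht : t * t = 1)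
    (h : s * (t * s) = t * (s * t)) (hc : ¬ Commute s t) : orderOf (s * t) = 3 := by
  have h3 : (s * t) ^ 3 = 1 := by
    calc (s * t) ^ 3 = (s * (t * s)) * (t * (s * t)) := by simp only [pow_succ, pow_zero, one_mul, mul_assoc]
      _ = s * (t * (s * s) * t) * s := by rw [← h]; simp only [mul_assoc]
      _ = 1 := by rw [hs, mul_one, ht, mul_one, hs]
  have : Fact (Nat.Prime 3) := ⟨Nat.prime_three⟩
  refine orderOf_eq_prime h3 ?_
  intro h1
  apply hc
  have : s = t := by
    calc s = s * (t * t) := by rw [ht, mul_one]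
      _ = t := by rw [← mul_assoc, h1, one_mul]
  rw [this]

lemma order4 {M : Type*} [Monoid M] {s t : M} (hs : s * s = 1) (ht : t * t = 1)
    (h : s * (t * (s * t)) = t * (s * (t * s))) (hc : ¬ Commute s t) : orderOf (s * t) = 4 := by
  have h4 : (s * t) ^ 4 = 1 := by
    calc (s * t) ^ 4 = (s * (t * (s * t))) * (s * (t * (s * t))) := by
          simp only [pow_succ, pow_zero, one_mul, mul_assoc]
      _ = s * (t * (s * (t * t) * s) * t) * s := by rw [h, ← h]; simp only [mul_assoc]; rw [h]
      _ = 1 := by rw [ht, mul_one, hs, mul_one, ht, mul_one, hs]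
  refine orderOf_eq_prime_pow (p := 2) (n := 1) (x := s * t) ?_ h4
  intro h2
  apply hc
  have h2' : s * (t * (s * t)) = 1 := by
    rw [← h2]; simp only [pow_succ, pow_zero, one_mul, mul_assoc]
  show s * t = t * s
  symm
  calc t * s = t * s * (s * (t * (s * t))) := by rw [h2', mul_one]
    _ = t * (s * s) * t * (s * t) := by simp only [mul_assoc]
    _ = s * t := by rw [hs, mul_one, ht, one_mul]

/-- Noncommuting simple reflections: the order is 3 or 4 and the braid relation holds. -/
lemma braid (hG : D.NotG2) {a b : V} (ha : a ∈ D.simpleRoots) (hb : b ∈ D.simpleRoots)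
    (hc : ¬ Commute (reflEnd a) (reflEnd b)) :
    ⟪a, b⟫ < 0 ∧
    ((orderOf (reflEnd a * reflEnd b) = 3 ∧
      reflEnd a * (reflEnd b * reflEnd a) = reflEnd b * (reflEnd a * reflEnd b) ∧
      (reflEnd a b = b + a ∧ reflEnd b a = a + b)) ∨
    (orderOf (reflEnd a * reflEnd b) = 4 ∧
      reflEnd a * (reflEnd b * (reflEnd a * reflEnd b)) =
      reflEnd b * (reflEnd a * (reflEnd b * reflEnd a)) ∧
      ((reflEnd a b = b + a ∧ reflEnd b a = a + (2 : ℝ) • b) ∨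
       (reflEnd a b = b + (2 : ℝ) • a ∧ reflEnd b a = a + b)))) := by
  have ha0 := D.ne0 (D.simple_root ha)
  have hb0 := D.ne0 (D.simple_root hb)
  have hneg : ⟪a, b⟫ < 0 := by
    have hne : a ≠ b := by rintro rfl; exact hc (Commute.refl _)
    refine lt_of_le_of_ne (D.simple_inner hG ha hb hne) (fun h0 => hc ?_)
    show reflEnd a * reflEnd b = reflEnd b * reflEnd a
    ext v
    have h1 : reflEnd a b = b := refl_orth h0
    have h2 : reflEnd b a = a := refl_orth (by rwa [real_inner_comm])
    obtain ⟨f, hf⟩ : ∃ f : ℝ, reflEnd a v = v - f • a := ⟨_, refl_apply a v⟩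
    obtain ⟨g, hg⟩ : ∃ g : ℝ, reflEnd b v = v - g • b := ⟨_, refl_apply b v⟩
    simp only [Module.End.mul_apply, map_sub, map_smul, hf, hg, h1, h2]
    module
  refine ⟨hneg, ?_⟩
  have hs := refl_mul_self ha0
  have ht := refl_mul_self hb0
  rcases rank_two hG ha.1 hb.1 hneg with ⟨h1, h2⟩ | ⟨h1, h2⟩ | ⟨h1, h2⟩
  · left
    have h := braid3 ha0 hb0 h1 h2
    exact ⟨order3 hs ht h hc, h, h1, h2⟩
  · right
    have h := braid4 ha0 hb0 h1 h2
    exact ⟨order4 hs ht h hc, h, Or.inl ⟨h1, h2⟩⟩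
  · right
    have h := (braid4 hb0 ha0 h2 h1).symm
    exact ⟨order4 hs ht h hc, h, Or.inr ⟨h1, h2⟩⟩

/-- If two inversions pair nonnegatively always, no braid occurs. -/
lemma fc_of_nonneg (hG : D.NotG2) {w : Module.End ℝ V} (hw : D.InWeyl w)
    (h : ∀ α ∈ D.inversions w, ∀ β ∈ D.inversions w, 0 ≤ ⟪α, β⟫) : D.FullyCommutative w := by
  refine ⟨hw, fun l hl hlw a ha b hb hc hinf => ?_⟩
  obtain ⟨hneg, hbr⟩ := braid hG ha hb hc
  have key : ∀ l1 l1' l2 : List V, wordProd (l1 ++ a :: l2) = w → wordProd (l1' ++ b :: l2) = w →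
      D.IsReducedWord (l1 ++ a :: l2) → D.IsReducedWord (l1' ++ b :: l2) → False := by
    intro l1 l1' l2 h1 h2 hr1 hr2
    have i1 := reduced_mid_inv hG hr1
    have i2 := reduced_mid_inv hG hr2
    rw [h1] at i1
    rw [h2] at i2
    have h3 := h _ i1 _ i2
    have hl2 : D.IsWord l2 := fun c hc => hr1.1 c (by simp [hc])
    rw [hl2.reverse.props.2.1] at h3
    linarith
  have redlike : ∀ m : List V, D.IsWord m → wordProd m = wordProd l → m.length = l.length →
      D.IsReducedWord m := by
    intro m hm h1 h2
    refine ⟨hm, fun m' hm' h3 => ?_⟩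
    rw [h2]
    exact hl.2 m' hm' (h3.trans h1)
  obtain ⟨l1, l2, hl12⟩ := hinf
  have hw1 : D.IsWord l1 := fun c hc => hl.1 c (by rw [← hl12]; simp [hc])
  have hw2 : D.IsWord l2 := fun c hc => hl.1 c (by rw [← hl12]; simp [hc])
  rcases hbr with ⟨ho, hb3, -⟩ | ⟨ho, hb4, -⟩
  · rw [ho] at hl12
    simp only [altWord] at hl12
    have e1 : l = (l1 ++ [a, b]) ++ a :: l2 := by rw [← hl12]; simp
    have e2 : wordProd ((l1 ++ [b, a]) ++ b :: l2) = wordProd l := by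
      rw [e1]
      simp only [wordProd_append, wordProd_cons, wordProd_nil, mul_one, mul_assoc]
      have := congrArg (fun f => wordProd l1 * (f * wordProd l2)) hb3
      simp only [mul_assoc] at this
      exact this.symm
    refine key (l1 ++ [a, b]) (l1 ++ [b, a]) l2 (e1 ▸ hlw) (e2.trans hlw) (e1 ▸ hl)
      (redlike _ ?_ e2 (by rw [e1]; simp))
    intro c hc'
    simp at hc'
    rcases hc' with h | rfl | rfl | rfl | h
    exacts [hw1 c h, hb, ha, hb, hw2 c h]
  · rw [ho] at hl12
    simp only [altWord] at hl12
    have e1 : l = (l1 ++ [a, b, a]) ++ b :: l2 := by rw [← hl12]; simp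
    have e2 : wordProd ((l1 ++ [b, a, b]) ++ a :: l2) = wordProd l := by
      rw [e1]
      simp only [wordProd_append, wordProd_cons, wordProd_nil, mul_one, mul_assoc]
      have := congrArg (fun f => wordProd l1 * (f * wordProd l2)) hb4
      simp only [mul_assoc] at this
      exact this.symm
    refine key (l1 ++ [b, a, b]) (l1 ++ [a, b, a]) l2 (e2.trans hlw) (e1 ▸ hlw)
      (redlike _ ?_ e2 (by rw [e1]; simp)) (e1 ▸ hl)
    intro c hc'
    simp at hc'
    rcases hc' with h | rfl | rfl | rfl | rfl | h
    exacts [hw1 c h, hb, ha, hb, ha, hw2 c h]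

lemma fc_right (hG : D.NotG2) {w : Module.End ℝ V} (hf : D.FullyCommutative w) {a : V}
    (ha : a ∈ D.simpleRoots) (hwa : a ∈ D.inversions w) :
    D.FullyCommutative (w * reflEnd a) := by
  refine ⟨hf.1.mul (InWeyl.refl ha), fun l hl hlw α hα β hβ hc hinf => ?_⟩
  obtain ⟨h1, h2⟩ := reduced_snoc hG ha hwa.2.2 hl hlw
  exact hf.2 _ h1 h2 α hα β hβ hc (hinf.trans (List.prefix_append l [a]).isInfix)

lemma fc_left {a : V} {t : List V} (hr : D.IsReducedWord (a :: t))
    (hf : D.FullyCommutative (wordProd (a :: t))) : D.FullyCommutative (wordProd t) := by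
  have ht : D.IsReducedWord t := reduced_right (l := [a]) hr
  refine ⟨⟨t, ht.1, rfl⟩, fun l hl hlw α hα β hβ hc hinf => ?_⟩
  have e : wordProd (a :: l) = wordProd (a :: t) := by rw [wordProd_cons, hlw, wordProd_cons]
  refine hf.2 (a :: l) ⟨?_, fun m hm hme => ?_⟩ e α hα β hβ hc
    (hinf.trans (List.suffix_cons a l).isInfix)
  · intro c hc'
    rcases List.mem_cons.mp hc' with rfl | h
    · exact hr.1 c (by simp)
    · exact hl.1 c h
  · have h1 := hr.2 m hm (hme.trans e)
    have h2 := hl.2 t ht.1 hlw.symm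
    simp at h1 ⊢
    omega

/-- inversion sets are closed under addition etc. -/
lemma neg_posMon {w : Module.End ℝ V} {γ : V} (h : γ ∈ D.inversions w) :
    -(w γ) ∈ D.posMon := D.mem_posMon (D.neg_pos_of_not h.2.1 h.2.2)

lemma not_pos_of_mon (hG : D.NotG2) {γ : V} (h : -γ ∈ D.posMon) : γ ∉ D.pos := by
  intro hc
  have h1 := D.pos_of_posMon hG (D.neg_root (D.pos_subset hc)) h
  exact D.not_pos_of_neg h1 hc

lemma fc_no_pair (hG : D.NotG2) {w : Module.End ℝ V} (hf : D.FullyCommutative w) {a b : V}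
    (ha : a ∈ D.simpleRoots) (hb : b ∈ D.simpleRoots) (hab : ⟪a, b⟫ < 0)
    (hwa : a ∈ D.inversions w) (hwb : b ∈ D.inversions w) : False := by
  have ha0 := D.ne0 (D.simple_root ha)
  have hb0 := D.ne0 (D.simple_root hb)
  have na := neg_posMon hwa
  have nb := neg_posMon hwb
  have hc : ¬ Commute (reflEnd a) (reflEnd b) := by
    intro hc
    have h1 : reflEnd a (reflEnd b a) = reflEnd b (reflEnd a a) :=
      congrArg (fun f => f a) hc.eq
    rw [refl_self ha0, map_neg] at h1
    have fin : ∀ p : ℝ, 0 < p → (2 : ℝ) • b + p • a = 0 → False := by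
      intro p hp h
      refine D.pos_not_opp ha.1 hb.1 (t := p / 2) (by linarith) ?_
      have h2 : b = (1 / 2 : ℝ) • ((2 : ℝ) • b + p • a) - (p / 2) • a := by module
      rw [h, smul_zero, zero_sub] at h2
      exact h2
    rcases rank_two hG ha.1 hb.1 hab with ⟨e1, e2⟩ | ⟨e1, e2⟩ | ⟨e1, e2⟩
    · simp only [e2, map_add, map_smul, e1, refl_self ha0] at h1
      refine fin 1 one_pos ?_
      rw [← sub_eq_zero] at h1
      rw [← h1]; module
    · simp only [e2, map_add, map_smul, e1, refl_self ha0] at h1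
      refine fin 1 one_pos ?_
      rw [← sub_eq_zero] at h1
      have h2 : (2 : ℝ) • b + (1 : ℝ) • a = (1 / 2 : ℝ) •
        (-a + (2 : ℝ) • (b + a) - -(a + (2 : ℝ) • b)) := by module
      rw [h2, h1, smul_zero]
    · simp only [e2, map_add, map_smul, e1, refl_self ha0] at h1
      refine fin 2 two_pos ?_
      rw [← sub_eq_zero] at h1
      rw [← h1]; module
  have hW := hf.1
  have mon2 : ∀ v, -v ∈ D.posMon → -((2 : ℝ) • v) ∈ D.posMon := by
    intro v hv
    convert D.posMon.add_mem hv hv using 1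
    module
  obtain ⟨-, hbr⟩ := braid hG ha hb hc
  rcases hbr with ⟨ho, -, h1, h2⟩ | ⟨ho, -, h12⟩
  · obtain ⟨l, hl, hlw⟩ := exists_reduced (((hW.mul (InWeyl.refl ha)).mul (InWeyl.refl hb)).mul
      (InWeyl.refl ha))
    have r1 := reduced_snoc hG ha (w := w * reflEnd a * reflEnd b) (by
      apply not_pos_of_mon hG
      simp only [Module.End.mul_apply, h1, h2, map_add, map_neg, refl_self ha0]
      convert nb using 1
      module) hl hlw
    have r2 := reduced_snoc hG hb (w := w * reflEnd a) (by
      apply not_pos_of_mon hG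
      simp only [Module.End.mul_apply, h1, h2, map_add, map_neg, refl_self ha0]
      convert D.posMon.add_mem na nb using 1
      module) r1.1 r1.2
    have r3 := reduced_snoc hG ha (w := w) hwa.2.2 r2.1 r2.2
    refine hf.2 _ r3.1 r3.2 a ha b hb hc ?_
    rw [ho]
    simp only [altWord]
    exact ⟨l, [], by simp⟩
  · obtain ⟨l, hl, hlw⟩ := exists_reduced ((((hW.mul (InWeyl.refl hb)).mul (InWeyl.refl ha)).mul
      (InWeyl.refl hb)).mul (InWeyl.refl ha))
    have r1 := reduced_snoc hG ha (w := w * reflEnd b * reflEnd a * reflEnd b) (by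
      apply not_pos_of_mon hG
      rcases h12 with ⟨h1, h2⟩ | ⟨h1, h2⟩
      all_goals
        simp only [Module.End.mul_apply, h1, h2, map_add, map_neg, map_smul, refl_self ha0,
          refl_self hb0]
        convert na using 1
        module) hl hlw
    have r2 := reduced_snoc hG hb (w := w * reflEnd b * reflEnd a) (by
      apply not_pos_of_mon hG
      rcases h12 with ⟨h1, h2⟩ | ⟨h1, h2⟩
      · simp only [Module.End.mul_apply, h1, h2, map_add, map_neg, map_smul, refl_self ha0,
          refl_self hb0]
        convert D.posMon.add_mem na nb using 1
        module
      · simp only [Module.End.mul_apply, h1, h2, map_add, map_neg, map_smul, refl_self ha0,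
          refl_self hb0]
        convert D.posMon.add_mem (mon2 _ na) nb using 1
        module) r1.1 r1.2
    have r3 := reduced_snoc hG ha (w := w * reflEnd b) (by
      apply not_pos_of_mon hG
      rcases h12 with ⟨h1, h2⟩ | ⟨h1, h2⟩
      · simp only [Module.End.mul_apply, h1, h2, map_add, map_neg, map_smul, refl_self ha0,
          refl_self hb0]
        convert D.posMon.add_mem na (mon2 _ nb) using 1
        module
      · simp only [Module.End.mul_apply, h1, h2, map_add, map_neg, map_smul, refl_self ha0,
          refl_self hb0]
        convert D.posMon.add_mem na nb using 1
        module) r2.1 r2.2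
    have r4 := reduced_snoc hG hb (w := w) hwb.2.2 r3.1 r3.2
    refine hf.2 _ r4.1 r4.2 a ha b hb hc ?_
    rw [ho]
    simp only [altWord]
    exact ⟨l, [], by simp⟩

end RootSystemData

namespace RootSystemData

variable {V : Type*} [NormedAddCommGroup V] [InnerProductSpace ℝ V] {D : RootSystemData V}

lemma coclosed {w : Module.End ℝ V} (hw : D.InWeyl w) {γ₁ γ₂ : V}
    (h1 : γ₁ ∈ D.pos) (h2 : γ₂ ∈ D.pos) (h : γ₁ + γ₂ ∈ D.inversions w)
    (h' : γ₂ ∉ D.inversions w) : γ₁ ∈ D.inversions w := by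
  rw [mem_inv hw] at *
  refine ⟨h1, fun hc => h.2 ?_⟩
  have h3 : w γ₂ ∈ D.pos := by by_contra h4; exact h' ⟨h2, h4⟩
  rw [map_add]
  refine D.pos_add _ hc _ h3 ?_
  rw [← map_add]
  exact hw.root (D.pos_subset h.1)

lemma inv_refl (hG : D.NotG2) {w : Module.End ℝ V} (hw : D.InWeyl w) {γ β : V}
    (hγ : γ ∈ D.inversions w) (hβ : β ∈ D.simpleRoots) (hβ' : β ∉ D.inversions w)
    (hp : 0 < ⟪γ, β⟫) : reflEnd β γ ∈ D.inversions w := by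
  have hne : γ ≠ β := by rintro rfl; exact hβ' hγ
  have hpos := D.refl_pos hG hβ hγ.1 hne
  rw [mem_inv hw] at *
  refine ⟨hpos, fun hc => hγ.2 ?_⟩
  have h3 : w β ∈ D.pos := by by_contra h4; exact hβ' ⟨hβ.1, h4⟩
  have m1 := D.mem_posMon hc
  have m2 := D.mem_posMon h3
  apply D.pos_of_posMon hG (hw.root (D.pos_subset hγ.1))
  have hβ0 := D.ne0 (D.simple_root hβ)
  rcases D.tri hG (D.pos_subset hγ.1) (D.simple_root hβ) hne hp with h | h | h
  · rw [refl_eq hβ0 (t := 1) (by rw [real_inner_comm]; linarith [h.2]), map_sub, map_smul] at m1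
    convert D.posMon.add_mem m1 m2 using 1
    module
  · rw [refl_eq hβ0 (t := 2) (by rw [real_inner_comm]; linarith [h.2]), map_sub, map_smul] at m1
    convert D.posMon.add_mem (D.posMon.add_mem m1 m2) m2 using 1
    module
  · rw [refl_eq hβ0 (t := 1) (by rw [real_inner_comm]; linarith [h.1, h.2]), map_sub, map_smul]
      at m1
    convert D.posMon.add_mem m1 m2 using 1
    module

/-- The configuration of a minimal counterexample. -/
structure Bad (D : RootSystemData V) (w : Module.End ℝ V) (x y : V) : Prop where
  hw : D.InWeyl w
  xs : x ∈ D.simpleRoots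
  xS : x ∈ D.inversions w
  yS : y ∈ D.inversions w
  xy : ⟪x, y⟫ < 0
  H1 : ∀ r ∈ D.inversions w, ∀ s ∈ D.inversions w, ⟪r, s⟫ < 0 → (r = x ∧ s = y) ∨ (r = y ∧ s = x)
  H2 : ∀ a ∈ D.simpleRoots, a ∈ D.inversions w → a = x

lemma Bad.step (hG : D.NotG2) {w : Module.End ℝ V} {x y α : V} (h : Bad D w x y)
    (hα : α ∈ D.simpleRoots) (hne : α ≠ x) (hS : reflEnd x α ∈ D.inversions w) :
    reflEnd α y ∈ D.inversions w ∧ ∃ k B : ℝ, (k = 1 ∨ k = 2) ∧ 0 < B ∧ ⟪x, x⟫ = 2 * B ∧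
      ⟪α, α⟫ = k ^ 2 * B ∧ ⟪x, α⟫ = - k * B ∧ ⟪y, y⟫ = 2 * B ∧ ⟪x, y⟫ = - B ∧ ⟪y, α⟫ = k * B := by
  have hx := D.simple_root h.xs
  have hy := D.pos_subset h.yS.1
  have hαr := D.simple_root hα
  have hxx := D.inner_pos hx
  have hyy := D.inner_pos hy
  have hαα := D.inner_pos hαr
  have hαS : α ∉ D.inversions w := fun hc => hne (h.H2 α hα hc)
  have hax : ⟪α, x⟫ < 0 := by
    refine lt_of_le_of_ne (D.simple_inner hG hα h.xs hne) (fun h0 => hαS ?_)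
    rwa [refl_orth (by rwa [real_inner_comm])] at hS
  have hxy := h.xy
  have hya : y ≠ α := by rintro rfl; exact hαS h.yS
  have hxα : ⟪x, α⟫ = ⟪α, x⟫ := real_inner_comm _ _
  have hyx : ⟪y, x⟫ = ⟪x, y⟫ := real_inner_comm _ _
  have hnx : α ≠ -x := by rintro rfl; exact D.not_pos_of_neg hα.1 h.xs.1
  have hny : x ≠ -y := by
    intro e
    have := h.yS.1
    rw [e] at hx
    exact D.not_pos_of_neg (e ▸ h.xs.1) this
  have hδx : 0 < ⟪reflEnd x α, x⟫ := by
    rw [inner_refl_left (D.ne0 hx), refl_self (D.ne0 hx), inner_neg_right]; linarith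
  have hδnx : reflEnd x α ≠ x := by
    intro e
    apply hnx
    rw [← refl_refl (D.ne0 hx) α, e, refl_self (D.ne0 hx)]
  have hδny : reflEnd x α ≠ y := by
    intro e; rw [e] at hδx; linarith
  have hyδ : 0 ≤ ⟪y, reflEnd x α⟫ := by
    by_contra hc
    rcases h.H1 _ h.yS _ hS (not_le.mp hc) with h1 | h1
    · exact hδny h1.2
    · exact hδnx h1.2
  have hq : 0 < ⟪y, α⟫ := by
    rw [refl_apply, inner_sub_right, real_inner_smul_right] at hyδ
    have : 2 * ⟪x, α⟫ / ⟪x, x⟫ < 0 := div_neg_of_neg_of_pos (by linarith) hxx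
    nlinarith
  have hsy := inv_refl hG h.hw h.yS hα hαS hq
  refine ⟨hsy, ?_⟩
  rcases D.tri_neg hG hαr hx hnx hax with ⟨c1, c2⟩ | ⟨c1, c2⟩ | ⟨c1, c2⟩
  · exfalso
    have e1 : reflEnd x α = α + x := by
      rw [refl_eq (D.ne0 hx) (t := -1) (by linarith)]; module
    have e2 : reflEnd α x = x + α := by
      rw [refl_eq (D.ne0 hαr) (t := -1) (by linarith)]; module
    have h3 : ⟪reflEnd α y, reflEnd x α⟫ = ⟪x, y⟫ := by
      rw [inner_refl_left (D.ne0 hαr), e1, map_add, refl_self (D.ne0 hαr), e2, ← hyx]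
      congr 1
      module
    rcases h.H1 _ hsy _ hS (by linarith) with h1 | h1
    · exact hδny h1.2
    · exact hδnx h1.2
  · have e1 : reflEnd x α = α + (2 : ℝ) • x := by
      rw [refl_eq (D.ne0 hx) (t := -2) (by linarith)]; module
    rw [e1, inner_add_right, real_inner_smul_right] at hyδ
    refine ⟨2, ⟪x, x⟫ / 2, Or.inr rfl, by linarith, ?_⟩
    rcases D.tri hG hy hαr hya hq with ⟨d1, d2⟩ | ⟨d1, d2⟩ | ⟨d1, d2⟩ <;>
    rcases D.tri_neg hG hx hy hny hxy with ⟨f1, f2⟩ | ⟨f1, f2⟩ | ⟨f1, f2⟩ <;>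
    first
    | (exfalso; linarith)
    | (refine ⟨?_, ?_, ?_, ?_, ?_, ?_⟩ <;> linarith)
  · have e1 : reflEnd x α = α + x := by
      rw [refl_eq (D.ne0 hx) (t := -1) (by linarith)]; module
    rw [e1, inner_add_right] at hyδ
    refine ⟨1, ⟪α, α⟫, Or.inl rfl, by linarith, ?_⟩
    rcases D.tri hG hy hαr hya hq with ⟨d1, d2⟩ | ⟨d1, d2⟩ | ⟨d1, d2⟩ <;>
    rcases D.tri_neg hG hx hy hny hxy with ⟨f1, f2⟩ | ⟨f1, f2⟩ | ⟨f1, f2⟩ <;>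
    first
    | (exfalso; linarith)
    | (refine ⟨?_, ?_, ?_, ?_, ?_, ?_⟩ <;> linarith)

lemma Bad.fin {w : Module.End ℝ V} {e1 e2 e3 e4 : V} {B : ℝ} (hB : 0 < B)
    (h : Bad D w (e3 - e2) (e1 + e2))
    (g11 : ⟪e1, e1⟫ = B) (g22 : ⟪e2, e2⟫ = B) (g12 : ⟪e1, e2⟫ = 0)
    (g13 : ⟪e1, e3⟫ = 0) (g23 : ⟪e2, e3⟫ = 0) (g44 : ⟪e4, e4⟫ = B) (g41 : ⟪e4, e1⟫ = 0)
    (g42 : ⟪e4, e2⟫ = 0) (g43 : ⟪e4, e3⟫ = 0)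
    (h1 : e1 - e2 ∈ D.inversions w) (h2 : e3 + e4 ∈ D.inversions w)
    (h3 : e4 - e2 ∈ D.pos) (h4 : e1 - e4 ∈ D.pos) : False := by
  have g21 : ⟪e2, e1⟫ = 0 := by rw [real_inner_comm, g12]
  have g31 : ⟪e3, e1⟫ = 0 := by rw [real_inner_comm, g13]
  have g32 : ⟪e3, e2⟫ = 0 := by rw [real_inner_comm, g23]
  have g14 : ⟪e1, e4⟫ = 0 := by rw [real_inner_comm, g41]
  have g24 : ⟪e2, e4⟫ = 0 := by rw [real_inner_comm, g42]
  have g34 : ⟪e3, e4⟫ = 0 := by rw [real_inner_comm, g43]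
  have a1 : e4 - e2 ∉ D.inversions w := by
    intro hc
    have := h.H1 _ hc _ h.yS (by
      simp only [inner_sub_left, inner_add_right, g41, g42, g21, g22]; linarith)
    rcases this with e | e
    · have := congrArg (fun v => ⟪v, e4⟫) e.1
      simp only [inner_sub_left, g44, g24, g34] at this
      linarith
    · have := congrArg (fun v => ⟪v, e1⟫) e.1
      simp only [inner_sub_left, inner_add_left, g41, g21, g11] at this
      linarith
  have a2 : e1 - e4 ∈ D.inversions w :=
    coclosed h.hw h4 h3 (by convert h1 using 1; abel) a1
  have := h.H1 _ a2 _ h2 (by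
      simp only [inner_sub_left, inner_add_right, g13, g14, g43, g44]; linarith)
  rcases this with e | e
  · have := congrArg (fun v => ⟪v, e1⟫) e.1
    simp only [inner_sub_left, g11, g41, g31, g21] at this
    linarith
  · have := congrArg (fun v => ⟪v, e2⟫) e.1
    simp only [inner_sub_left, inner_add_left, g12, g42, g22] at this
    linarith

set_option maxHeartbeats 2000000 in
lemma Bad.core (hG : D.NotG2) {w : Module.End ℝ V} {e1 e2 e3 α : V} {k B : ℝ}
    (hk : k = 1 ∨ k = 2) (hB : 0 < B)
    (h : Bad D w (e3 - e2) (e1 + e2)) (hαe : α = k • e2)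
    (hα : α ∈ D.simpleRoots)
    (hS : reflEnd (e3 - e2) α ∈ D.inversions w) (hsy : reflEnd α (e1 + e2) ∈ D.inversions w)
    (g11 : ⟪e1, e1⟫ = B) (g22 : ⟪e2, e2⟫ = B) (g33 : ⟪e3, e3⟫ = B) (g12 : ⟪e1, e2⟫ = 0)
    (g13 : ⟪e1, e3⟫ = 0) (g23 : ⟪e2, e3⟫ = 0) : False := by
  have g21 : ⟪e2, e1⟫ = 0 := by rw [real_inner_comm, g12]
  have g31 : ⟪e3, e1⟫ = 0 := by rw [real_inner_comm, g13]
  have g32 : ⟪e3, e2⟫ = 0 := by rw [real_inner_comm, g23]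
  have k0 : 0 < k := by rcases hk with rfl | rfl <;> norm_num
  have hx := D.simple_root h.xs
  have hx0 := D.ne0 hx
  have hαr := D.simple_root hα
  have hα0 := D.ne0 hαr
  -- action of the two reflections
  have sx : ∀ v t, ⟪e3, v⟫ - ⟪e2, v⟫ = t * B → reflEnd (e3 - e2) v = v - t • (e3 - e2) := by
    intro v t ht
    apply refl_eq hx0
    simp only [inner_sub_left, inner_sub_right, g33, g22, g23, g32]
    linarith
  have sa : ∀ v t, 2 * ⟪e2, v⟫ = t * B → reflEnd α v = v - t • e2 := by
    intro v t ht
    rw [refl_eq hα0 (t := t / k), hαe, smul_smul, div_mul_cancel₀ _ k0.ne']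
    rw [hαe]
    simp only [real_inner_smul_left, real_inner_smul_right, g22]
    field_simp
    linear_combination ht
  have sx2 : reflEnd (e3 - e2) e2 = e3 := by
    rw [sx e2 (-1) (by rw [g32, g22]; ring)]; module
  have sx3 : reflEnd (e3 - e2) e3 = e2 := by
    rw [sx e3 1 (by rw [g33, g23]; ring)]; module
  have sx1 : reflEnd (e3 - e2) e1 = e1 := by
    rw [sx e1 0 (by rw [g31, g21]; ring)]; module
  have sa1 : reflEnd α e1 = e1 := by rw [sa e1 0 (by rw [g21]; ring)]; module
  have sa2 : reflEnd α e2 = -e2 := by rw [sa e2 2 (by rw [g22])]; module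
  have sa3 : reflEnd α e3 = e3 := by rw [sa e3 0 (by rw [g23]; ring)]; module
  have hδ : k • e3 ∈ D.inversions w := by rwa [hαe, map_smul, sx2] at hS
  have h12 : e1 - e2 ∈ D.inversions w := by
    rwa [map_add, sa1, sa2, ← sub_eq_add_neg] at hsy
  have hne12 : e1 - e2 ≠ e3 - e2 := by
    intro e
    have := congrArg (fun v => ⟪v, e1⟫) e
    simp only [inner_sub_left, g11, g21, g31] at this
    linarith
  have hζ : e1 - e3 ∈ D.pos := by
    have := D.refl_pos hG h.xs h12.1 hne12
    rwa [map_sub, sx1, sx2] at this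
  have hζS : e1 - e3 ∉ D.inversions w := by
    intro hc
    rcases h.H1 _ hc _ h.xS (by
      simp only [inner_sub_left, inner_sub_right, g13, g12, g33, g32]; linarith) with e | e
    · have := congrArg (fun v => ⟪v, e1⟫) e.1
      simp only [inner_sub_left, g11, g21, g31] at this
      linarith
    · have := congrArg (fun v => ⟪v, e2⟫) e.1
      simp only [inner_sub_left, inner_add_left, g12, g32, g22] at this
      linarith
  have hneαx : e3 - e2 ≠ α := by
    intro e
    have := congrArg (fun v => ⟪v, e3⟫) e
    rw [hαe] at this
    simp only [inner_sub_left, g33, g23, real_inner_smul_left] at this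
    linarith
  have h23p : e2 + e3 ∈ D.pos := by
    have := D.refl_pos hG hα h.xS.1 hneαx
    rw [map_sub, sa3, sa2] at this
    convert this using 1
    abel
  have h23 : e2 + e3 ∈ D.inversions w :=
    coclosed h.hw h23p hζ (by convert h.yS using 1; abel) hζS
  have hαS : α ∉ D.inversions w := fun hc => hneαx (h.H2 α hα hc).symm
  -- a further simple root
  have hu : D.InWeyl (w * reflEnd (e3 - e2) * reflEnd α * reflEnd (e3 - e2)) :=
    ((h.hw.mul (InWeyl.refl h.xs)).mul (InWeyl.refl hα)).mul (InWeyl.refl h.xs)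
  obtain ⟨β, hβ, hβu⟩ := exists_simple hG hu (γ := e1 + e2) (by
    rw [mem_inv hu]
    refine ⟨h.yS.1, ?_⟩
    simp only [Module.End.mul_apply, map_add, sx1, sx2, sx3, sa1, sa3]
    rw [← map_add]
    exact h.yS.2.2)
  have hβu' := ((mem_inv hu).mp hβu).2
  have hβr := D.simple_root hβ
  have hβx : β ≠ e3 - e2 := by
    rintro rfl
    apply hβu'
    have := D.neg_pos_of_not h23.2.1 h23.2.2
    simp only [Module.End.mul_apply, map_sub, sx2, sx3, sa3, sa2, map_neg]
    rw [map_add] at this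
    convert this using 1
    abel
  have hβα : β ≠ α := by
    rintro rfl
    apply hβu'
    have h1 : w β ∈ D.pos := by
      by_contra hc; exact hαS ((mem_inv h.hw).mpr ⟨hβ.1, hc⟩)
    rw [hαe] at h1 ⊢
    rw [hαe] at sa3
    simp only [Module.End.mul_apply, map_smul, sx2, sx3, sa3] at h1 ⊢
    exact h1
  have hβS : β ∉ D.inversions w := fun hc => hβx (h.H2 β hβ hc)
  have bx := D.simple_inner hG hβ h.xs hβx
  have bα := D.simple_inner hG hβ hα hβα
  have b2 : ⟪β, e2⟫ ≤ 0 := by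
    rw [hαe, real_inner_smul_right] at bα
    by_contra hc
    have := mul_pos k0 (not_le.mp hc)
    linarith
  rw [inner_sub_right] at bx
  -- the root τ
  have sτ : ∃ τ, τ = β - (2 * ⟪β, e3⟫ / B) • e3 ∧ τ ∈ D.inversions w := by
    refine ⟨_, rfl, ?_⟩
    have p1 := D.refl_pos hG h.xs hβ.1 hβx
    have p2 : reflEnd α (reflEnd (e3 - e2) β) ∈ D.pos := by
      refine D.refl_pos hG hα p1 (fun e => ?_)
      have e' : β = k • e3 := by
        rw [← refl_refl hx0 β, e, hαe, map_smul, sx2]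
      exact hβS (e' ▸ hδ)
    have p3 : reflEnd (e3 - e2) (reflEnd α (reflEnd (e3 - e2) β)) ∈ D.pos := by
      refine D.refl_pos hG h.xs p2 (fun e => ?_)
      have e' : β = e2 + e3 := by
        rw [← refl_refl hx0 β, ← refl_refl hα0 (reflEnd (e3 - e2) β), e]
        simp only [map_sub, map_neg, sa3, sa2, sx2, sx3]
        abel
      exact hβS (e' ▸ h23)
    have e : reflEnd (e3 - e2) (reflEnd α (reflEnd (e3 - e2) β)) =
        β - (2 * ⟪β, e3⟫ / B) • e3 := by
      rw [sx β ((⟪β, e3⟫ - ⟪β, e2⟫) / B)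
        (by rw [real_inner_comm, real_inner_comm e2]; field_simp)]
      simp only [map_sub, map_smul, sa3, sa2, map_neg]
      rw [sa β (2 * ⟪β, e2⟫ / B) (by rw [real_inner_comm]; field_simp)]
      simp only [map_sub, map_smul, sx3, sx2, map_neg]
      rw [sx β ((⟪β, e3⟫ - ⟪β, e2⟫) / B)
        (by rw [real_inner_comm, real_inner_comm e2]; field_simp)]
      module
    rw [← e, mem_inv h.hw]
    exact ⟨p3, hβu'⟩
  obtain ⟨τ, hτ, hτS⟩ := sτ
  have b3 : ⟪β, e3⟫ < 0 := by
    refine lt_of_le_of_ne (by linarith) (fun h0 => hβS ?_)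
    rw [h0] at hτ
    simp at hτ
    exact hτ ▸ hτS
  have b12 : 0 ≤ ⟪β, e1⟫ + ⟪β, e2⟫ := by
    by_contra hc
    rcases h.H1 _ hτS _ h.yS (by
      rw [hτ]
      simp only [inner_sub_left, real_inner_smul_left, inner_add_right, g31, g32]
      linarith) with e | e
    · have := congrArg (fun v => ⟪v, e3⟫) e.1
      rw [hτ] at this
      simp only [inner_sub_left, real_inner_smul_left, g33, g23] at this
      rw [div_mul_cancel₀ _ hB.ne'] at this
      have h5 := congrArg (fun v => ⟪v, e2⟫) e.1
      rw [hτ] at h5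
      simp only [inner_sub_left, real_inner_smul_left, g32, g22] at h5
      have h6 := congrArg (fun v => ⟪v, e1⟫) e.1
      rw [hτ] at h6
      simp only [inner_sub_left, real_inner_smul_left, g31, g21] at h6
      -- β is minus a positive root
      have h7 : β = -(e2 + e3) := by
        have h8 : ⟪β, e3⟫ = -B := by linarith
        have h9 := e.1
        rw [hτ, h8, sub_eq_iff_eq_add] at h9
        rw [h9, show 2 * -B / B = -2 by field_simp]
        module
      exact D.not_pos_of_neg (h7 ▸ hβ.1) h23p
    · have h6 := congrArg (fun v => ⟪v, e1⟫) e.2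
      simp only [inner_sub_left, inner_add_left, g11, g31, g21] at h6
      linarith
  have hββ := D.inner_pos hβr
  have hβ0 := D.ne0 hβr
  have c1 : ⟪e1, β⟫ = ⟪β, e1⟫ := real_inner_comm _ _
  have c2 : ⟪e2, β⟫ = ⟪β, e2⟫ := real_inner_comm _ _
  have c3 : ⟪e3, β⟫ = ⟪β, e3⟫ := real_inner_comm _ _
  have hxx : ⟪e3 - e2, e3 - e2⟫ = 2 * B := by
    simp only [inner_sub_left, inner_sub_right, g33, g22, g23, g32]; ring
  have hβnx : β ≠ -(e3 - e2) := by
    intro e; exact D.not_pos_of_neg (e ▸ hβ.1) h.xs.1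
  rcases eq_or_lt_of_le b2 with b2 | b2
  · -- `β` is orthogonal to `e2`
    have opp : ∀ t : ℝ, 0 < t → ⟪β + t • e3, β + t • e3⟫ ≠ 0 := by
      intro t ht h0
      have h1 := eq_neg_of_add_eq_zero_left (inner_self_eq_zero.mp h0)
      refine D.pos_not_opp hδ.1 hβ.1 (t := t / k) (by positivity) ?_
      rw [h1, smul_smul, div_mul_cancel₀ _ k0.ne']
    have exp : ∀ t : ℝ, ⟪β + t • e3, β + t • e3⟫ = ⟪β, β⟫ + 2 * t * ⟪β, e3⟫ + t ^ 2 * B := by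
      intro t
      simp only [inner_add_left, inner_add_right, real_inner_smul_left, real_inner_smul_right,
        g33, c3]
      ring
    rcases D.tri_neg hG hβr hx hβnx (by rw [inner_sub_right]; linarith) with
      ⟨d1, d2⟩ | ⟨d1, d2⟩ | ⟨d1, d2⟩
    · rw [hxx] at d1 d2
      rw [inner_sub_right, b2] at d2
      have b3' : ⟪β, e3⟫ = -B := by linarith
      by_cases hζβ : e1 - e3 = β
      · have hsβ : reflEnd (e3 - e2) β ∈ D.inversions w := by
          rw [← hζβ, map_sub, sx1, sx3]; exact h12
        obtain ⟨-, k', B', hk', hB', q1, q2, -⟩ := h.step hG hβ hβx hsβ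
        rw [hxx] at q1
        rw [d1] at q2
        rcases hk' with rfl | rfl <;> linarith
      · have hζζ : ⟪e1 - e3, e1 - e3⟫ = 2 * B := by
          simp only [inner_sub_left, inner_sub_right, g33, g11, g13, g31]; ring
        have hζp : ⟪e1 - e3, β⟫ = ⟪β, e1⟫ + B := by rw [inner_sub_left, c1, c3, b3']; ring
        have hζp' : 0 < ⟪e1 - e3, β⟫ := by rw [hζp]; linarith
        have b1 : ⟪β, e1⟫ = 0 := by
          rcases D.tri hG (D.pos_subset hζ) hβr hζβ hζp' with ⟨f1, f2⟩ | ⟨f1, f2⟩ | ⟨f1, f2⟩ <;>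
            linarith
        refine h.fin hB (e4 := β + e3) g11 g22 g12 g13 g23 ?_ ?_ ?_ ?_ h12 ?_ ?_ ?_
        · simp only [inner_add_left, inner_add_right, c3, b3', g33, d1]; ring
        · simp only [inner_add_left, b1, g31]; ring
        · simp only [inner_add_left, b2, g32]; ring
        · simp only [inner_add_left, b3', g33]; ring
        · rw [hτ, b3', show 2 * -B / B = -2 by field_simp] at hτS
          convert hτS using 1
          module
        · have := D.refl_pos hG h.xs hβ.1 hβx
          rw [sx β (-1) (by rw [c3, c2, b3', b2]; ring)] at this
          convert this using 1
          module
        · have := D.refl_pos hG hβ hζ hζβ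
          rw [refl_eq hβ0 (t := 1) (by rw [real_inner_comm, hζp, b1, d1]; ring)] at this
          convert this using 1
          module
    · exfalso
      rw [hxx] at d1 d2
      rw [inner_sub_right, b2] at d2
      refine opp 2 two_pos ?_
      rw [exp]; linarith
    · exfalso
      rw [hxx] at d1
      rw [inner_sub_right, b2] at d2
      refine opp 1 one_pos ?_
      rw [exp]; linarith
  · -- `β` is adjacent to `α`
    have bes : ⟪β, e1⟫ ^ 2 + ⟪β, e2⟫ ^ 2 + ⟪β, e3⟫ ^ 2 ≤ ⟪β, β⟫ * B := by
      have h0 : 0 ≤ ⟪B • β - ⟪β, e1⟫ • e1 - ⟪β, e2⟫ • e2 - ⟪β, e3⟫ • e3,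
        B • β - ⟪β, e1⟫ • e1 - ⟪β, e2⟫ • e2 - ⟪β, e3⟫ • e3⟫ := real_inner_self_nonneg
      simp only [inner_sub_left, inner_sub_right, real_inner_smul_left, real_inner_smul_right,
        g11, g22, g33, g12, g13, g23, g21, g31, g32, c1, c2, c3] at h0
      have h1 : 0 ≤ B * (⟪β, β⟫ * B - (⟪β, e1⟫ ^ 2 + ⟪β, e2⟫ ^ 2 + ⟪β, e3⟫ ^ 2)) := by
        linarith
      have := nonneg_of_mul_nonneg_right h1 hB
      linarith
    have q1 : ⟪β, e2⟫ ^ 2 ≤ ⟪β, e1⟫ ^ 2 := by nlinarith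
    have q3 : ⟪β, e2⟫ ^ 2 ≤ ⟪β, e3⟫ ^ 2 := by nlinarith
    have hβnα : β ≠ -α := by intro e; exact D.not_pos_of_neg (e ▸ hβ.1) hα.1
    have hαα : ⟪α, α⟫ = k ^ 2 * B := by
      rw [hαe]; simp only [real_inner_smul_left, real_inner_smul_right, g22]; ring
    have hβα' : ⟪β, α⟫ = k * ⟪β, e2⟫ := by rw [hαe, real_inner_smul_right]
    have t1 : ⟪β, β⟫ = k ^ 2 * B ∧ ⟪β, e2⟫ = -(k * B / 2) := by
      rcases D.tri_neg hG hβr hαr hβnα (by rw [hβα']; nlinarith) with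
        ⟨d1, d2⟩ | ⟨d1, d2⟩ | ⟨d1, d2⟩ <;> rw [hαα] at d1 <;> rw [hβα'] at d2 <;>
        try rw [hαα] at d2
      · exact ⟨d1, by apply mul_left_cancel₀ k0.ne'; linarith⟩
      · exfalso
        have : ⟪β, e2⟫ = -(k * B) := by apply mul_left_cancel₀ k0.ne'; linarith
        rw [this] at q1 q3 bes
        rw [d1] at bes
        have : 0 < k ^ 2 * B ^ 2 := by positivity
        nlinarith
      · exfalso
        have e' : ⟪β, β⟫ = k ^ 2 * B / 2 := by linarith
        have : ⟪β, e2⟫ = -(k * B / 2) := by apply mul_left_cancel₀ k0.ne'; linarith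
        rw [this] at q1 q3 bes
        rw [e'] at bes
        have : 0 < k ^ 2 * B ^ 2 := by positivity
        nlinarith
    obtain ⟨nβ, v2⟩ := t1
    have v3 : ⟪β, e3⟫ = -(k * B / 2) := by
      by_contra hc
      have hlt : ⟪β, e3 - e2⟫ < 0 := by
        rw [inner_sub_right]
        refine lt_of_le_of_ne bx (fun h0 => hc (by linarith))
      have hBB : 0 < B ^ 2 := by positivity
      rcases D.tri_neg hG hβr hx hβnx hlt with
        ⟨d1, d2⟩ | ⟨d1, d2⟩ | ⟨d1, d2⟩ <;> rw [hxx] at d1 <;> rw [inner_sub_right] at d2 <;>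
        try rw [hxx] at d2
      · rcases hk with rfl | rfl <;> linarith
      · rcases hk with rfl | rfl
        · linarith
        · have : ⟪β, e3⟫ = -(3 * B) := by linarith
          rw [this, nβ] at bes
          nlinarith
      · rcases hk with rfl | rfl
        · have : ⟪β, e3⟫ = -(3 * B / 2) := by linarith
          rw [this, nβ] at bes
          nlinarith
        · linarith
    have v1 : ⟪β, e1⟫ = k * B / 2 := by
      have hr : k • e1 ∈ D.roots := by
        have h0 := D.reflect_mem α hαr _ (D.pos_subset h12.1)
        have h1 : reflEnd (e1 - e2) e2 = e1 := by
          rw [refl_eq (D.ne0 (D.pos_subset h12.1)) (t := -1)]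
          · module
          · simp only [inner_sub_left, inner_sub_right, g11, g12, g21, g22]; ring
        rwa [hαe, map_smul, h1] at h0
      have hkk : ⟪k • e1, k • e1⟫ = k ^ 2 * B := by
        simp only [real_inner_smul_left, real_inner_smul_right, g11]; ring
      have hne : β ≠ k • e1 := by
        intro e
        rw [e, real_inner_smul_left, g12] at b2
        linarith
      have hp : ⟪β, k • e1⟫ = k * ⟪β, e1⟫ := real_inner_smul_right _ _ _
      have hkB : 0 < k ^ 2 * B := by positivity
      rcases D.tri hG hβr hr hne (by rw [hp]; apply mul_pos k0; linarith) with
        ⟨d1, d2⟩ | ⟨d1, d2⟩ | ⟨d1, d2⟩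
      · rw [hp, hkk] at d2
        apply mul_left_cancel₀ k0.ne'; linarith
      · linarith
      · linarith
    have hkk : k * k⁻¹ = 1 := mul_inv_cancel₀ k0.ne'
    have m34 : e1 - e2 - (2 / k) • β ∈ D.inversions w := by
      have := inv_refl hG h.hw h12 hβ hβS (by
        rw [inner_sub_left, c1, c2, v1, v2]; have := mul_pos k0 hB; linarith)
      rwa [refl_eq hβ0 (t := 2 / k) (by
        rw [inner_sub_right, v1, v2, nβ]; field_simp; ring)] at this
    refine h.fin hB (e4 := e1 - e2 - e3 - (2 / k) • β) g11 g22 g12 g13 g23 ?_ ?_ ?_ ?_ h12 ?_ ?_ ?_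
    · simp only [inner_sub_left, inner_sub_right, real_inner_smul_left, real_inner_smul_right,
        g11, g22, g33, g12, g13, g23, g21, g31, g32, c1, c2, c3, v1, v2, v3, nβ]
      field_simp; ring
    · simp only [inner_sub_left, real_inner_smul_left, g11, g21, g31, v1]; field_simp; ring
    · simp only [inner_sub_left, real_inner_smul_left, g12, g22, g32, v2]; field_simp; ring
    · simp only [inner_sub_left, real_inner_smul_left, g13, g23, g33, v3]; field_simp; ring
    · convert m34 using 1; abel
    · have p1 := D.refl_pos hG h.xs m34.1 (by
        intro e
        have := congrArg (fun v => ⟪v, e2⟫) e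
        simp only [inner_sub_left, real_inner_smul_left, g12, g22, g32, v2] at this
        field_simp at this
        linarith)
      have e5 : reflEnd (e3 - e2) (e1 - e2 - (2 / k) • β) = e1 - e3 - (2 / k) • β := by
        have := sx β 0 (by rw [c3, c2, v3, v2]; ring)
        rw [map_sub, map_sub, map_smul, sx1, sx2, this]
        module
      rw [e5] at p1
      have p2 := D.refl_pos hG hα p1 (by
        intro e
        have n1 : ⟪e1 - e3 - (2 / k) • β, e1 - e3 - (2 / k) • β⟫ = 2 * B := by
          simp only [inner_sub_left, inner_sub_right, real_inner_smul_left,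
            real_inner_smul_right, g11, g33, g13, g31, c1, c3, v1, v3, nβ]
          field_simp; ring
        rw [e, hαα] at n1
        rcases hk with rfl | rfl <;> linarith)
      simp only [map_sub, map_smul, sa1, sa3] at p2
      rw [sa β (-k) (by rw [c2, v2]; ring)] at p2
      convert p2 using 1
      rw [smul_sub, smul_smul, show 2 / k * -k = -2 by field_simp]
      module
    · have hne : e2 + e3 ≠ β := by intro e; exact hβS (e ▸ h23)
      have := D.refl_pos hG hβ h23p hne
      rw [refl_eq hβ0 (t := -(2 / k)) (by
        rw [inner_add_right, v2, v3, nβ]; field_simp; ring)] at this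
      convert this using 1
      module

lemma Bad.false (hG : D.NotG2) {w : Module.End ℝ V} {x y : V} (h : Bad D w x y) : False := by
  have hx0 := D.ne0 (D.simple_root h.xs)
  have hu := h.hw.mul (InWeyl.refl h.xs)
  have hyx : y ≠ x := by
    intro e
    have := h.xy
    rw [e] at this
    linarith [D.inner_pos (D.simple_root h.xs)]
  obtain ⟨α, hα, hαu⟩ := exists_simple hG hu (γ := reflEnd x y) (by
    rw [mem_inv hu]
    refine ⟨D.refl_pos hG h.xs h.yS.1 hyx, ?_⟩
    rw [Module.End.mul_apply, refl_refl hx0]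
    exact h.yS.2.2)
  rw [mem_inv hu] at hαu
  have hne : α ≠ x := by
    rintro rfl
    apply hαu.2
    rw [Module.End.mul_apply, refl_self hx0, map_neg]
    exact D.neg_pos_of_not h.xS.2.1 h.xS.2.2
  have hS : reflEnd x α ∈ D.inversions w := by
    rw [mem_inv h.hw]
    exact ⟨D.refl_pos hG h.xs hα.1 hne, hαu.2⟩
  obtain ⟨hsy, k, B, hk, hB, q1, q2, q3, q4, q5, q6⟩ := h.step hG hα hne hS
  have k0 : k ≠ 0 := by rcases hk with rfl | rfl <;> norm_num
  obtain ⟨e2, rfl⟩ : ∃ e2, α = k • e2 := ⟨k⁻¹ • α, by rw [smul_smul, mul_inv_cancel₀ k0, one_smul]⟩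
  obtain ⟨e1, rfl⟩ : ∃ e1, y = e1 + e2 := ⟨y - e2, by abel⟩
  obtain ⟨e3, rfl⟩ : ∃ e3, x = e3 - e2 := ⟨x + e2, by abel⟩
  have c1 : ⟪e2, e1⟫ = ⟪e1, e2⟫ := real_inner_comm _ _
  have c2 : ⟪e3, e2⟫ = ⟪e2, e3⟫ := real_inner_comm _ _
  have c3 : ⟪e3, e1⟫ = ⟪e1, e3⟫ := real_inner_comm _ _
  simp only [inner_add_left, inner_add_right, inner_sub_left, inner_sub_right,
    real_inner_smul_left, real_inner_smul_right, c1, c2, c3] at q1 q2 q3 q4 q5 q6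
  have g22 : ⟪e2, e2⟫ = B := by
    apply mul_left_cancel₀ (pow_ne_zero 2 k0); linarith
  have g23 : ⟪e2, e3⟫ = 0 := by
    apply mul_left_cancel₀ k0; rw [g22] at q3; linarith
  have g12 : ⟪e1, e2⟫ = 0 := by
    apply mul_left_cancel₀ k0; rw [g22] at q6; linarith
  exact h.core hG hk hB rfl hα hS hsy (by linarith) g22 (by linarith) g12 (by linarith) g23

lemma nonneg_of_fc (hG : D.NotG2) : ∀ n : ℕ, ∀ l : List V, l.length = n → D.IsReducedWord l →
    D.FullyCommutative (wordProd l) → ∀ α ∈ D.inversions (wordProd l),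
    ∀ β ∈ D.inversions (wordProd l), 0 ≤ ⟪α, β⟫ := by
  intro n
  induction n with
  | zero =>
    intro l hl _ _ α hα
    rw [List.length_eq_zero_iff] at hl
    subst hl
    exact absurd hα.1 hα.2.2
  | succ n ih =>
    intro l hl hr hf p hp q hq
    by_contra hneg
    rw [not_le] at hneg
    have hw := hf.1
    -- removing a right descent
    have right : ∀ a ∈ D.simpleRoots, a ∈ D.inversions (wordProd l) →
        ∀ r ∈ D.inversions (wordProd l), ∀ s ∈ D.inversions (wordProd l),
        r ≠ a → s ≠ a → 0 ≤ ⟪r, s⟫ := by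
      intro a ha haw r hrw s hsw hra hsa
      have ha0 := D.ne0 (D.simple_root ha)
      have hf' := fc_right hG hf ha haw
      obtain ⟨l', hl', hlw⟩ := exists_reduced hf'.1
      have h1 := reduced_snoc hG ha haw.2.2 hl' hlw
      have h2 : l'.length = n := by
        have u1 := h1.1.2 l hr.1 h1.2.symm
        have u2 := hr.2 _ h1.1.1 h1.2
        simp at u1 u2
        omega
      have h3 := ih l' h2 hl' (hlw ▸ hf') (reflEnd a r) ?_ (reflEnd a s) ?_
      · rwa [inner_refl ha0] at h3
      · rw [hlw, mem_inv hf'.1, Module.End.mul_apply, refl_refl ha0]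
        exact ⟨D.refl_pos hG ha hrw.1 hra, hrw.2.2⟩
      · rw [hlw, mem_inv hf'.1, Module.End.mul_apply, refl_refl ha0]
        exact ⟨D.refl_pos hG ha hsw.1 hsa, hsw.2.2⟩
    -- removing the left descent
    obtain ⟨b, t, rfl⟩ : ∃ b t, l = b :: t := by
      cases l with
      | nil => simp at hl
      | cons b t => exact ⟨b, t, rfl⟩
    have hb : b ∈ D.simpleRoots := hr.1 b (by simp)
    have hft := fc_left hr hf
    have hrt : D.IsReducedWord t := reduced_right (l := [b]) hr
    have left : ∀ r ∈ D.inversions (wordProd (b :: t)), ∀ s ∈ D.inversions (wordProd (b :: t)),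
        ⟪r, s⟫ < 0 → wordProd t r = b ∨ wordProd t s = b := by
      intro r hrw s hsw hrs
      have aux : ∀ r ∈ D.inversions (wordProd (b :: t)), wordProd t r ≠ b →
          r ∈ D.inversions (wordProd t) := by
        intro r hrw hne
        rw [mem_inv hft.1]
        refine ⟨hrw.1, fun hc => hrw.2.2 ?_⟩
        rw [wordProd_cons]
        exact D.refl_pos hG hb hc hne
      by_contra hc
      push Not at hc
      have := ih t (by simpa using hl) hrt hft r (aux r hrw hc.1) s (aux s hsw hc.2)
      linarith
    obtain ⟨a, ha, haw⟩ := exists_simple hG hw hp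
    have ha0 := D.ne0 (D.simple_root ha)
    have main : ∀ y ∈ D.inversions (wordProd (b :: t)), ⟪a, y⟫ < 0 → False := by
      intro y hy hay
      have hya : y ≠ a := by
        intro e; rw [e] at hay; linarith [D.inner_pos (D.simple_root ha)]
      have H2 : ∀ c ∈ D.simpleRoots, c ∈ D.inversions (wordProd (b :: t)) → c = a := by
        intro c hc hcw
        by_contra hne
        by_cases hcy : y = c
        · subst hcy
          exact fc_no_pair hG hf ha hc hay haw hcw
        · have := right c hc hcw a haw y hy (Ne.symm hne) hcy
          linarith
      have hab : wordProd t a ≠ b := by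
        intro e
        have hu := hw.mul (InWeyl.refl ha)
        -- then `s_b w = w s_a`
        have hy2 : reflEnd a y ∈ D.inversions (wordProd (b :: t) * reflEnd a) := by
          rw [mem_inv hu, Module.End.mul_apply, refl_refl ha0]
          exact ⟨D.refl_pos hG ha hy.1 hya, hy.2.2⟩
        obtain ⟨c, hc, hcu⟩ := exists_simple hG hu hy2
        rw [mem_inv hu] at hcu
        have hca : c ≠ a := by
          rintro rfl
          apply hcu.2
          rw [Module.End.mul_apply, refl_self ha0, map_neg]
          exact D.neg_pos_of_not haw.2.1 haw.2.2
        have hcS : reflEnd a c ∈ D.inversions (wordProd (b :: t)) := by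
          rw [mem_inv hw]
          exact ⟨D.refl_pos hG ha hc.1 hca, hcu.2⟩
        apply hca
        apply H2 c hc
        rw [mem_inv hw]
        refine ⟨hc.1, fun hcp => ?_⟩
        -- `w (s_a c) = s_b w c`
        have e2 : wordProd (b :: t) (reflEnd a c) = reflEnd b (wordProd (b :: t) c) := by
          have eb : wordProd (b :: t) a = -b := by
            rw [wordProd_cons, Module.End.mul_apply, e, refl_self (D.ne0 (D.simple_root hb))]
          have n1 := hw.inner a a
          have n2 := hw.inner a c
          rw [eb] at n1 n2
          simp only [inner_neg_left, inner_neg_right, neg_neg] at n1 n2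
          rw [refl_apply a c, map_sub, map_smul, eb, refl_apply b, n1, ← n2]
          module
        by_cases hcb : wordProd (b :: t) c = b
        · have eb : wordProd (b :: t) (-a) = b := by
            rw [map_neg, wordProd_cons, Module.End.mul_apply, e,
              refl_self (D.ne0 (D.simple_root hb)), neg_neg]
          have := hw.inj (hcb.trans eb.symm)
          exact D.not_pos_of_neg (this ▸ hc.1) ha.1
        · apply hcS.2.2
          rw [e2]
          exact D.refl_pos hG hb hcp hcb
      have hyb : wordProd t y = b := (left a haw y hy hay).resolve_left hab
      refine Bad.false hG (w := wordProd (b :: t)) (x := a) (y := y)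
        ⟨hw, ha, haw, hy, hay, ?_, H2⟩
      intro r hrw s hsw hrs
      by_cases hra : r = a
      · left
        refine ⟨hra, ?_⟩
        rcases left r hrw s hsw hrs with h | h
        · exact absurd (hra ▸ h) hab
        · exact hft.1.inj (h.trans hyb.symm)
      · by_cases hsa : s = a
        · right
          refine ⟨?_, hsa⟩
          rcases left r hrw s hsw hrs with h | h
          · exact hft.1.inj (h.trans hyb.symm)
          · exact absurd (hsa ▸ h) hab
        · have := right a ha haw r hrw s hsw hra hsa
          linarith
    by_cases hpa : p = a
    · exact main q hq (hpa ▸ hneg)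
    · by_cases hqa : q = a
      · refine main p hp ?_
        rw [real_inner_comm, ← hqa]; exact hneg
      · have := right a ha haw p hp q hq hpa hqa
        linarith

lemma cpair_nonneg_iff {α β : V} (hβ : β ∈ D.roots) : 0 ≤ cpair α β ↔ 0 ≤ ⟪α, β⟫ := by
  have := D.inner_pos hβ
  rw [cpair, div_nonneg_iff]
  constructor
  · rintro (h | h)
    · linarith [h.1]
    · linarith [h.2]
  · intro h
    exact Or.inl ⟨by linarith, this.le⟩

end RootSystemData

/-- If `Φ` is irreducible, reduced, crystallographic and not of
type `G₂`, with Weyl group `W`, then `w ∈ W` is fully commutative if and only if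
`⟨α, β⟩ ≥ 0` for all `α, β` in the inversion set `Φ(w)`. -/
theorem fullyCommutative_iff_pairing_nonneg
    {V : Type*} [NormedAddCommGroup V] [InnerProductSpace ℝ V]
    (D : RootSystemData V)
    (hirr : D.IsIrreducible) (hG2 : D.NotG2)
    (w : Module.End ℝ V) (hw : D.InWeyl w) :
    D.FullyCommutative w ↔
      ∀ α ∈ D.inversions w, ∀ β ∈ D.inversions w, 0 ≤ cpair α β := by
  constructor
  · intro hf α hα β hβ
    obtain ⟨l, hl, rfl⟩ := RootSystemData.exists_reduced hw
    exact (RootSystemData.cpair_nonneg_iff (D := D) (D.pos_subset hβ.1)).mpr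
      (RootSystemData.nonneg_of_fc hG2 _ l rfl hl hf α hα β hβ)
  · intro h
    exact RootSystemData.fc_of_nonneg hG2 hw (fun α hα β hβ =>
      (RootSystemData.cpair_nonneg_iff (D := D) (D.pos_subset hβ.1)).mp (h α hα β hβ))
end
end

section
/- Suppose Φ is irreducible and not of type G₂. Let α, β ∈ Φ⁺ satisfy ⟨α,β⟩ < 0, and let e_α ∈ 𝔤_α, e_β ∈ 𝔤_β be nonzero root vectors. Then ad(e_α + e_β)⁴ ≠ 0 in End(𝔤); in particular the nilpotent element e_α + e_β has height at least 4. -/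
/- Background setup: a finite reduced crystallographic root system `Φ` with chosen
positive roots `Φ⁺` in a euclidean space `V`, the Cartan pairing, and the basic
combinatorial notions used in the statement. -/

open scoped RealInnerProductSpace

noncomputable section

variable {V : Type*} [NormedAddCommGroup V] [InnerProductSpace ℝ V]

/- The Lie-theoretic setup: a finite-dimensional complex simple Lie algebra `𝔤`
with Cartan subalgebra `𝔱`, whose root space decomposition is indexed by the
root system `Φ ⊆ V`. -/

/-- A finite-dimensional simple complex Lie algebra `L`, together with a Cartan
subalgebra and its root space decomposition, whose root system is `Φ ⊆ V` with a
choice of positive roots (determining the Borel subalgebra `𝔟 = 𝔱 ⊕ 𝔫`). -/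
structure LieRootData (V : Type*) [NormedAddCommGroup V] [InnerProductSpace ℝ V]
    (L : Type*) [LieRing L] [LieAlgebra ℂ L] extends RootSystemData V where
  /-- the Cartan subalgebra 𝔱 -/
  cartan : LieSubalgebra ℂ L
  /-- the root space 𝔤_α attached to each root α -/
  rs : V → Submodule ℂ L
  finiteDim : FiniteDimensional ℂ L
  isSimple : LieAlgebra.IsSimple ℂ L
  isCartan : cartan.IsCartanSubalgebra
  rs_dim : ∀ α ∈ roots, Module.finrank ℂ (rs α) = 1
  sup_eq_top : cartan.toSubmodule ⊔ (⨆ α ∈ roots, rs α) = ⊤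
  indep : ∀ α ∈ roots, rs α ⊓ (cartan.toSubmodule ⊔ ⨆ β ∈ roots \ {α}, rs β) = ⊥
  weight_vec : ∀ α ∈ roots, ∀ h ∈ cartan, ∀ x ∈ rs α, ∃ c : ℂ, ⁅h, x⁆ = c • x
  bracket_mem : ∀ α ∈ roots, ∀ β ∈ roots, α + β ∈ roots →
    ∀ x ∈ rs α, ∀ y ∈ rs β, ⁅x, y⁆ ∈ rs (α + β)
  bracket_ne_zero : ∀ α ∈ roots, ∀ β ∈ roots, α + β ∈ roots →
    ∀ x ∈ rs α, x ≠ 0 → ∀ y ∈ rs β, y ≠ 0 → ⁅x, y⁆ ≠ 0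
  bracket_eq_zero : ∀ α ∈ roots, ∀ β ∈ roots, α + β ∉ roots → α + β ≠ 0 →
    ∀ x ∈ rs α, ∀ y ∈ rs β, ⁅x, y⁆ = 0
  bracket_cartan_mem : ∀ α ∈ roots, ∀ x ∈ rs α, ∀ y ∈ rs (-α), ⁅x, y⁆ ∈ cartan

namespace LieRootData

variable {L : Type*} [LieRing L] [LieAlgebra ℂ L] (D : LieRootData V L)

/-- The nilradical `𝔫 = ⊕_{α ∈ Φ⁺} 𝔤_α` of the Borel subalgebra, as a submodule. -/
def nilrad : Submodule ℂ L := ⨆ α ∈ D.pos, D.rs α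

/-- The Borel subalgebra `𝔟 = 𝔱 ⊕ 𝔫`, as a submodule. -/
def borel : Submodule ℂ L := D.cartan.toSubmodule ⊔ D.nilrad

/-- The subspace `𝔞_Ψ = ⊕_{α ∈ Ψ} 𝔤_α` attached to a subset `Ψ ⊆ Φ⁺`. -/
def aSubspace (S : Set V) : Submodule ℂ L := ⨆ α ∈ S, D.rs α

end LieRootData

/-- A subspace of `𝔫` is spherical if `ad(x)^4 = 0` for every `x` in it. -/
def IsSphericalSubspace {L : Type*} [LieRing L] [LieAlgebra ℂ L]
    (a : Submodule ℂ L) : Prop :=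
  ∀ x ∈ a, (LieAlgebra.ad ℂ L x) ^ 4 = 0

/-- The height of a nilpotent element `x`: `max {n | ad(x)^n ≠ 0}`. -/
noncomputable def heightOf {L : Type*} [LieRing L] [LieAlgebra ℂ L] (x : L) : ℕ :=
  sSup {n : ℕ | (LieAlgebra.ad ℂ L x) ^ n ≠ 0}

section Helpers

theorem aux_A2 {L : Type*} [LieRing L] [LieAlgebra ℂ L] (e f x : L) (a a' b b' : ℂ)
    (he : e ≠ 0) (hf : f ≠ 0) (hz : ⁅e, f⁆ ≠ 0)
    (h1 : ⁅e, ⁅e, x⁆⁆ = 0) (h2 : ⁅f, ⁅f, x⁆⁆ = 0)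
    (h3 : ⁅e, ⁅e, f⁆⁆ = 0) (h4 : ⁅f, ⁅e, f⁆⁆ = 0)
    (hyz : ⁅⁅e, x⁆, ⁅e, f⁆⁆ ≠ 0)
    (ha : ⁅⁅f, ⁅e, x⁆⁆, e⁆ = a • e) (ha' : ⁅⁅f, ⁅e, x⁆⁆, f⁆ = a' • f)
    (hb' : ⁅⁅e, ⁅f, x⁆⁆, e⁆ = b' • e) (hb : ⁅⁅e, ⁅f, x⁆⁆, f⁆ = b • f) :
    ⁅e + f, ⁅e + f, ⁅e + f, ⁅e + f, x⁆⁆⁆⁆ ≠ 0 := by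
  have hye : ⁅⁅e, x⁆, e⁆ = 0 := by rw [← lie_skew, h1, neg_zero]
  have hwf : ⁅⁅f, x⁆, f⁆ = 0 := by rw [← lie_skew, h2, neg_zero]
  have hfe : ⁅f, e⁆ = - ⁅e, f⁆ := (lie_skew f e).symm
  have e1 : ⁅⁅e, x⁆, ⁅e, f⁆⁆ = a • e := by
    rw [← ha, lie_lie f ⁅e, x⁆ e, hye, hfe, lie_neg, lie_zero, zero_sub, neg_neg]
  have ha0 : a ≠ 0 := by
    rintro rfl; apply hyz; rw [e1, zero_smul]
  have e2 : (a + a') • ⁅e, f⁆ = (-a) • ⁅e, f⁆ := by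
    have t1 : ⁅⁅f, ⁅e, x⁆⁆, ⁅e, f⁆⁆ = (a + a') • ⁅e, f⁆ := by
      rw [leibniz_lie, ha, ha', smul_lie, lie_smul, add_smul]
    rw [← t1, lie_lie, e1, h4, lie_smul, hfe, lie_zero, sub_zero, smul_neg, neg_smul]
  have e2' := smul_left_injective ℂ hz e2
  have f1 : ⁅⁅f, x⁆, ⁅e, f⁆⁆ = (-b) • f := by
    rw [neg_smul, ← hb, lie_lie e ⁅f, x⁆ f, hwf]; simp
  have f2 : (b' + b) • ⁅e, f⁆ = (-b) • ⁅e, f⁆ := by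
    have t1 : ⁅⁅e, ⁅f, x⁆⁆, ⁅e, f⁆⁆ = (b' + b) • ⁅e, f⁆ := by
      rw [leibniz_lie, hb', hb, smul_lie, lie_smul, add_smul]
    rw [← t1, lie_lie, f1, h3, lie_smul]; simp
  have f2' := smul_left_injective ℂ hz f2
  have g1 : (b' - a) • e = a • e := by
    have t1 : ⁅⁅⁅e, f⁆, x⁆, e⁆ = (b' - a) • e := by
      rw [lie_lie e f x, sub_lie, ha, hb', sub_smul]
    have t2 : ⁅⁅e, f⁆, e⁆ = 0 := by rw [← lie_skew, h3, neg_zero]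
    rw [← t1, lie_lie ⁅e, f⁆ x e, t2, ← lie_skew x e, lie_neg, lie_skew, e1, lie_zero, sub_zero]
  have g1' := smul_left_injective ℂ he g1
  have k1 : ⁅e + f, ⁅e + f, x⁆⁆ = ⁅f, ⁅e, x⁆⁆ + ⁅e, ⁅f, x⁆⁆ := by
    simp only [add_lie, lie_add, h1, h2]; abel
  have k2 : ⁅e + f, ⁅f, ⁅e, x⁆⁆ + ⁅e, ⁅f, x⁆⁆⁆ = (-3 * a) • e + (3 * a) • f := by
    rw [← lie_skew]
    simp only [add_lie, lie_add, ha, ha', hb, hb']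
    have q1 : a' = -2 * a := by linear_combination e2'
    have q2 : b' = 2 * a := by linear_combination g1'
    have q3 : b = - a := by linear_combination (f2' - g1') / 2
    rw [q1, q2, q3]; module
  have k3 : ⁅e + f, (-3 * a) • e + (3 * a) • f⁆ = (6 * a) • ⁅e, f⁆ := by
    simp only [add_lie, lie_add, lie_smul, lie_self, hfe]; module
  rw [k1, k2, k3]
  exact smul_ne_zero (by simpa using ha0) hz

theorem aux_B2 {L : Type*} [LieRing L] [LieAlgebra ℂ L] (e f x : L) (a b : ℂ)
    (hz : ⁅e, f⁆ ≠ 0) (hfz : ⁅f, ⁅e, f⁆⁆ ≠ 0)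
    (h1 : ⁅f, x⁆ = 0) (h3 : ⁅e, ⁅e, f⁆⁆ = 0)
    (hxz : ⁅x, ⁅e, f⁆⁆ ≠ 0)
    (ha : ⁅⁅e, x⁆, e⁆ = a • e) (hb : ⁅⁅e, x⁆, f⁆ = b • f) :
    ⁅e + f, ⁅e + f, ⁅e + f, ⁅e + f, x⁆⁆⁆⁆ ≠ 0 := by
  have hfe : ⁅f, e⁆ = - ⁅e, f⁆ := (lie_skew f e).symm
  have hxf : ⁅x, f⁆ = 0 := by rw [← lie_skew, h1, neg_zero]
  have e1 : ⁅x, ⁅e, f⁆⁆ = (-b) • f := by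
    rw [neg_smul, ← hb, lie_lie e x f, hxf, lie_zero, zero_sub, neg_neg]
  have hb0 : b ≠ 0 := by
    rintro rfl; apply hxz; rw [e1, neg_zero, zero_smul]
  have e2 : (a + b) • ⁅e, f⁆ = (-b) • ⁅e, f⁆ := by
    have t1 : ⁅⁅e, x⁆, ⁅e, f⁆⁆ = (a + b) • ⁅e, f⁆ := by
      rw [leibniz_lie, ha, hb, smul_lie, lie_smul, add_smul]
    rw [← t1, lie_lie, e1, h3, lie_smul]; simp
  have e2' := smul_left_injective ℂ hz e2
  have k1 : ⁅e + f, x⁆ = ⁅e, x⁆ := by simp only [add_lie, h1, add_zero]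
  have k2 : ⁅e + f, ⁅e, x⁆⁆ = (2 * b) • e + (-b) • f := by
    rw [← lie_skew, lie_add, ha, hb]
    have q1 : a = -2 * b := by linear_combination e2'
    rw [q1]; module
  have k3 : ⁅e + f, (2 * b) • e + (-b) • f⁆ = (-3 * b) • ⁅e, f⁆ := by
    simp only [add_lie, lie_add, lie_smul, lie_self, hfe]; module
  have k4 : ⁅e + f, (-3 * b) • ⁅e, f⁆⁆ = (-3 * b) • ⁅f, ⁅e, f⁆⁆ := by
    rw [lie_smul, add_lie, h3, zero_add]
  rw [k1, k2, k3, k4]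
  exact smul_ne_zero (by simpa using hb0) hfz

theorem inner_pos_of_root {V : Type*} [NormedAddCommGroup V] [InnerProductSpace ℝ V]
    (D : RootSystemData V) {α : V} (hα : α ∈ D.roots) : 0 < ⟪α, α⟫ :=
  real_inner_self_pos.2 (D.ne_zero α hα)

theorem reflEnd_eq {V : Type*} [NormedAddCommGroup V] [InnerProductSpace ℝ V] (α β : V) :
    reflEnd β α = α - cpair α β • β := by
  simp only [reflEnd, cpair, LinearMap.sub_apply, LinearMap.id_apply, LinearMap.comp_apply,
    LinearMap.smul_apply, LinearMap.toSpanSingleton_apply, smul_eq_mul]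
  congr 2
  simp [real_inner_comm]
  ring

theorem neg_mem_roots {V : Type*} [NormedAddCommGroup V] [InnerProductSpace ℝ V]
    (D : RootSystemData V) {α : V} (hα : α ∈ D.roots) : -α ∈ D.roots := by
  have h := D.reflect_mem α hα α hα
  have h0 := (inner_pos_of_root D hα).ne'
  have : cpair α α = 2 := by unfold cpair; field_simp
  rw [reflEnd_eq, this] at h
  convert h using 1; module

theorem cpair_comb {V : Type*} [NormedAddCommGroup V] [InnerProductSpace ℝ V]
    (D : RootSystemData V) {α β : V} (hα : α ∈ D.roots) (s t : ℝ) :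
    cpair (s • α + t • β) α = 2 * s + t * cpair β α := by
  have h0 := (inner_pos_of_root D hα).ne'
  unfold cpair
  rw [inner_add_left, inner_smul_left, inner_smul_left]
  field_simp
  simp
  ring

/-- Non-roots are detected by pairing `±3`. -/
theorem not_root {V : Type*} [NormedAddCommGroup V] [InnerProductSpace ℝ V]
    (D : RootSystemData V) (hG2 : D.NotG2) {α β γ : V} (hα : α ∈ D.roots) (s t : ℝ)
    (hγ : γ = s • α + t • β)
    (h : 2 * s + t * cpair β α = 3 ∨ 2 * s + t * cpair β α = -3) : γ ∉ D.roots ∧ γ ≠ 0 := by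
  rw [← cpair_comb D hα, ← hγ] at h
  constructor
  · intro hr
    have := hG2 γ hr α hα
    tauto
  · rintro rfl
    have : cpair (0 : V) α = 0 := by simp [cpair]
    rw [this] at h
    norm_num at h

theorem strict_cs {V : Type*} [NormedAddCommGroup V] [InnerProductSpace ℝ V]
    (D : RootSystemData V) {α β : V} (hα : α ∈ D.pos) (hβ : β ∈ D.pos)
    (hneg : ⟪α, β⟫ < 0) : -⟪α, β⟫ < ‖α‖ * ‖β‖ := by
  have hαr := D.pos_subset hα
  have hβr := D.pos_subset hβ
  have h1 : -⟪α, β⟫ ≤ ‖α‖ * ‖β‖ := by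
    have := abs_real_inner_le_norm α β
    rw [abs_of_neg hneg] at this; exact this
  refine lt_of_le_of_ne h1 fun h => ?_
  have h2 : ⟪α, β⟫ = -(‖α‖ * ‖β‖) := by linarith
  rw [← neg_eq_iff_eq_neg, ← inner_neg_right, ← norm_neg β, inner_eq_norm_mul_iff_real,
    norm_neg] at h2
  have hb : ‖β‖ ≠ 0 := norm_ne_zero_iff.2 (D.ne_zero β hβr)
  have ha : ‖α‖ ≠ 0 := norm_ne_zero_iff.2 (D.ne_zero α hαr)
  have h3 : α = (-(‖α‖ / ‖β‖)) • β := by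
    have : (‖β‖)⁻¹ • (‖β‖ • α) = (‖β‖)⁻¹ • (‖α‖ • -β) := by rw [h2]
    rw [smul_smul, inv_mul_cancel₀ hb, one_smul] at this
    rw [div_eq_mul_inv]; refine this.trans ?_; module
  have hp : 0 < ‖α‖ / ‖β‖ := by positivity
  rcases D.reduced β hβr _ (h3 ▸ hαr) with h | h
  · linarith
  · rw [h, neg_one_smul] at h3
    have := (D.pos_iff β hβr).1 hβ
    rw [← h3] at this
    exact this hα

theorem pairing_cases {V : Type*} [NormedAddCommGroup V] [InnerProductSpace ℝ V]
    (D : RootSystemData V) (hG2 : D.NotG2) {α β : V} (hα : α ∈ D.pos) (hβ : β ∈ D.pos)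
    (hneg : ⟪α, β⟫ < 0) :
    (cpair α β = -1 ∧ cpair β α = -1) ∨ (cpair α β = -2 ∧ cpair β α = -1) ∨
      (cpair α β = -1 ∧ cpair β α = -2) := by
  have hαr := D.pos_subset hα
  have hβr := D.pos_subset hβ
  have ha := inner_pos_of_root D hαr
  have hb := inner_pos_of_root D hβr
  have hcs := strict_cs D hα hβ hneg
  have hm : cpair α β < 0 := by
    unfold cpair; exact div_neg_of_neg_of_pos (by linarith) hb
  have hn : cpair β α < 0 := by
    unfold cpair; rw [real_inner_comm]; exact div_neg_of_neg_of_pos (by linarith) ha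
  have hmn : cpair α β * cpair β α < 4 := by
    unfold cpair
    rw [real_inner_comm α β, div_mul_div_comm, div_lt_iff₀ (by positivity)]
    rw [real_inner_self_eq_norm_sq, real_inner_self_eq_norm_sq]
    nlinarith
  have g1 := hG2 α hαr β hβr
  have g2 := hG2 β hβr α hαr
  obtain ⟨m, hm'⟩ := D.crystallographic α hαr β hβr
  obtain ⟨n, hn'⟩ := D.crystallographic β hβr α hαr
  rw [hm'] at g1 hm hmn ⊢
  rw [hn'] at g2 hn hmn ⊢
  clear hm' hn' hcs ha hb
  have g1' : m ≠ -3 := fun h => g1.2 (by rw [h]; norm_num)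
  have g2' : n ≠ -3 := fun h => g2.2 (by rw [h]; norm_num)
  clear g1 g2
  norm_cast at hm hn hmn
  have m1 : -4 < m := by nlinarith
  have n1 : -4 < n := by nlinarith
  interval_cases m <;> interval_cases n <;>
    first | (exfalso; omega) | norm_num

section Lie
variable {V : Type*} [NormedAddCommGroup V] [InnerProductSpace ℝ V]
    {L : Type*} [LieRing L] [LieAlgebra ℂ L] (D : LieRootData V L)

theorem br_mem {α β γ : V} (hα : α ∈ D.roots) (hβ : β ∈ D.roots) (hγ : γ ∈ D.roots)
    (h : α + β = γ) {x y : L} (hx : x ∈ D.rs α) (hy : y ∈ D.rs β) : ⁅x, y⁆ ∈ D.rs γ := by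
  subst h; exact D.bracket_mem α hα β hβ hγ x hx y hy

theorem br_ne {α β γ : V} (hα : α ∈ D.roots) (hβ : β ∈ D.roots) (hγ : γ ∈ D.roots)
    (h : α + β = γ) {x y : L} (hx : x ∈ D.rs α) (hy : y ∈ D.rs β) (hx0 : x ≠ 0) (hy0 : y ≠ 0) :
    ⁅x, y⁆ ≠ 0 := by
  subst h; exact D.bracket_ne_zero α hα β hβ hγ x hx hx0 y hy hy0

theorem br_zero {α β γ : V} (hα : α ∈ D.roots) (hβ : β ∈ D.roots) (hγ : γ ∉ D.roots ∧ γ ≠ 0)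
    (h : α + β = γ) {x y : L} (hx : x ∈ D.rs α) (hy : y ∈ D.rs β) : ⁅x, y⁆ = 0 := by
  subst h; exact D.bracket_eq_zero α hα β hβ hγ.1 hγ.2 x hx y hy

theorem exists_vec {α : V} (hα : α ∈ D.roots) : ∃ x ∈ D.rs α, x ≠ 0 := by
  have h := D.rs_dim α hα
  apply Submodule.exists_mem_ne_zero_of_ne_bot
  intro hb
  rw [hb] at h
  simp at h

theorem case_A2 (hG2 : D.toRootSystemData.NotG2) {α β : V} (hα : α ∈ D.roots) (hβ : β ∈ D.roots)
    (hm : cpair α β = -1) (hn : cpair β α = -1)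
    {e f : L} (he : e ∈ D.rs α) (he0 : e ≠ 0) (hf : f ∈ D.rs β) (hf0 : f ≠ 0) :
    ∃ x : L, ⁅e + f, ⁅e + f, ⁅e + f, ⁅e + f, x⁆⁆⁆⁆ ≠ 0 := by
  have hab : α + β ∈ D.roots := by
    have := D.reflect_mem α hα β hβ
    rw [reflEnd_eq, hm] at this
    convert this using 1; module
  have nα := neg_mem_roots D.toRootSystemData hα
  have nβ := neg_mem_roots D.toRootSystemData hβ
  have nab := neg_mem_roots D.toRootSystemData hab
  obtain ⟨x, hx, hx0⟩ := exists_vec D nab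
  have hy : ⁅e, x⁆ ∈ D.rs (-β) := br_mem D hα nab nβ (by abel) he hx
  have hy0 : ⁅e, x⁆ ≠ 0 := br_ne D hα nab nβ (by abel) he hx he0 hx0
  have hw : ⁅f, x⁆ ∈ D.rs (-α) := br_mem D hβ nab nα (by abel) hf hx
  have hz : ⁅e, f⁆ ∈ D.rs (α + β) := br_mem D hα hβ hab rfl he hf
  have hz0 : ⁅e, f⁆ ≠ 0 := br_ne D hα hβ hab rfl he hf he0 hf0
  have c1 := D.bracket_cartan_mem β hβ f hf _ hy
  have c2 := D.bracket_cartan_mem α hα e he _ hw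
  obtain ⟨a, ha⟩ := D.weight_vec α hα _ c1 e he
  obtain ⟨a', ha'⟩ := D.weight_vec β hβ _ c1 f hf
  obtain ⟨b', hb'⟩ := D.weight_vec α hα _ c2 e he
  obtain ⟨b, hb⟩ := D.weight_vec β hβ _ c2 f hf
  refine ⟨x, aux_A2 e f x a a' b b' he0 hf0 hz0 ?_ ?_ ?_ ?_ ?_ ha ha' hb' hb⟩
  · exact br_zero D hα nβ (not_root D.toRootSystemData hG2 hα (β := β) 1 (-1) (by module)
      (by rw [hn]; norm_num)) rfl he hy
  · exact br_zero D hβ nα (not_root D.toRootSystemData hG2 hβ (β := α) 1 (-1) (by module)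
      (by rw [hm]; norm_num)) rfl hf hw
  · exact br_zero D hα hab (not_root D.toRootSystemData hG2 hα (β := β) 2 1 (by module)
      (by rw [hn]; norm_num)) rfl he hz
  · exact br_zero D hβ hab (not_root D.toRootSystemData hG2 hβ (β := α) 2 1 (by module)
      (by rw [hm]; norm_num)) rfl hf hz
  · exact br_ne D nβ hab hα (by abel) hy hz hy0 hz0

theorem case_B2 (hG2 : D.toRootSystemData.NotG2) {α β : V} (hα : α ∈ D.roots) (hβ : β ∈ D.roots)
    (hm : cpair α β = -2) (hn : cpair β α = -1)
    {e f : L} (he : e ∈ D.rs α) (he0 : e ≠ 0) (hf : f ∈ D.rs β) (hf0 : f ≠ 0) :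
    ∃ x : L, ⁅e + f, ⁅e + f, ⁅e + f, ⁅e + f, x⁆⁆⁆⁆ ≠ 0 := by
  have hab : α + β ∈ D.roots := by
    have := D.reflect_mem β hβ α hα
    rw [reflEnd_eq, hn] at this
    convert this using 1; module
  have habb : β + (α + β) ∈ D.roots := by
    have := D.reflect_mem α hα β hβ
    rw [reflEnd_eq, hm] at this
    convert this using 1; module
  have nα := neg_mem_roots D.toRootSystemData hα
  obtain ⟨x, hx, hx0⟩ := exists_vec D nα
  have hz : ⁅e, f⁆ ∈ D.rs (α + β) := br_mem D hα hβ hab rfl he hf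
  have hz0 : ⁅e, f⁆ ≠ 0 := br_ne D hα hβ hab rfl he hf he0 hf0
  have c1 := D.bracket_cartan_mem α hα e he _ hx
  obtain ⟨a, ha⟩ := D.weight_vec α hα _ c1 e he
  obtain ⟨b, hb⟩ := D.weight_vec β hβ _ c1 f hf
  refine ⟨x, aux_B2 e f x a b hz0 ?_ ?_ ?_ ?_ ha hb⟩
  · exact br_ne D hβ hab habb rfl hf hz hf0 hz0
  · exact br_zero D hβ nα (not_root D.toRootSystemData hG2 hα (β := β) (-1) 1 (by module)
      (by rw [hn]; norm_num)) rfl hf hx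
  · exact br_zero D hα hab (not_root D.toRootSystemData hG2 hα (β := β) 2 1 (by module)
      (by rw [hn]; norm_num)) rfl he hz
  · exact br_ne D nα hab hβ (by abel) hx hz hx0 hz0

/-- Filtration by the values of the functional `⟪v, ·⟫`. -/
def filt (v : V) (t : ℝ) : Submodule ℂ L :=
  Submodule.span ℂ {x | (x ∈ D.cartan ∧ t ≤ 0) ∨ ∃ γ ∈ D.roots, t ≤ ⟪v, γ⟫ ∧ x ∈ D.rs γ}

theorem filt_step (v : V) {α : V} (hα : α ∈ D.roots) (h1 : 1 ≤ ⟪v, α⟫) {e : L}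
    (he : e ∈ D.rs α) (t : ℝ) {y : L} (hy : y ∈ filt D v t) : ⁅e, y⁆ ∈ filt D v (t + 1) := by
  unfold filt at hy
  induction hy using Submodule.span_induction with
  | zero => simp
  | add x y _ _ hx hy => rw [lie_add]; exact Submodule.add_mem _ hx hy
  | smul c x _ hx => rw [lie_smul]; exact Submodule.smul_mem _ _ hx
  | mem x hx =>
    rcases hx with ⟨hx, ht⟩ | ⟨γ, hγ, ht, hx⟩
    · obtain ⟨c, hc⟩ := D.weight_vec α hα x hx e he
      rw [← lie_skew, hc]
      refine Submodule.neg_mem _ (Submodule.smul_mem _ _ (Submodule.subset_span ?_))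
      exact Or.inr ⟨α, hα, by linarith, he⟩
    · by_cases h0 : α + γ = 0
      · have hg : γ = -α := (neg_eq_of_add_eq_zero_right h0).symm
        subst hg
        refine Submodule.subset_span (Or.inl ⟨D.bracket_cartan_mem α hα e he x hx, ?_⟩)
        rw [inner_neg_right] at ht; linarith
      · by_cases hr : α + γ ∈ D.roots
        · refine Submodule.subset_span (Or.inr ⟨α + γ, hr, ?_, D.bracket_mem α hα γ hγ hr e he x hx⟩)
          rw [inner_add_right]; linarith
        · rw [D.bracket_eq_zero α hα γ hγ hr h0 e he x hx]
          exact Submodule.zero_mem _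

theorem nilp (v : V) {α β : V} (hα : α ∈ D.roots) (hβ : β ∈ D.roots) (h1 : 1 ≤ ⟪v, α⟫)
    (h2 : 1 ≤ ⟪v, β⟫) {e f : L} (he : e ∈ D.rs α) (hf : f ∈ D.rs β) :
    ∃ N : ℕ, ∀ n ≥ N, (LieAlgebra.ad ℂ L (e + f)) ^ n = 0 := by
  obtain ⟨M, hM⟩ : ∃ M : ℝ, ∀ γ ∈ D.roots, ⟪v, γ⟫ ≤ M := by
    obtain ⟨M, hM⟩ := (D.finite.image (fun γ => ⟪v, γ⟫)).bddAbove
    exact ⟨M, fun γ hγ => hM ⟨γ, hγ, rfl⟩⟩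
  have hMα := hM α hα
  have htop : filt D v (-M) = ⊤ := by
    rw [eq_top_iff, ← D.sup_eq_top]
    refine sup_le ?_ (iSup₂_le fun γ hγ => ?_)
    · intro x hx
      exact Submodule.subset_span (Or.inl ⟨hx, by linarith⟩)
    · intro x hx
      refine Submodule.subset_span (Or.inr ⟨γ, hγ, ?_, hx⟩)
      have := hM (-γ) (neg_mem_roots D.toRootSystemData hγ)
      rw [inner_neg_right] at this; linarith
  have hpow : ∀ n : ℕ, ∀ y, ((LieAlgebra.ad ℂ L (e + f)) ^ n) y ∈ filt D v (-M + n) := by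
    intro n
    induction n with
    | zero => intro y; simp [htop]
    | succ n ih =>
      intro y
      rw [pow_succ', Module.End.mul_apply, LieAlgebra.ad_apply, add_lie]
      push_cast
      rw [← add_assoc]
      exact Submodule.add_mem _ (filt_step D v hα h1 he _ (ih y)) (filt_step D v hβ h2 hf _ (ih y))
  obtain ⟨N, hN⟩ := exists_nat_gt (2 * M)
  refine ⟨N, fun n hn => ?_⟩
  have hnN : (N : ℝ) ≤ n := by exact_mod_cast hn
  have hbot : filt D v (-M + n) = ⊥ := by
    unfold filt
    rw [Submodule.span_eq_bot]
    rintro x (⟨_, h⟩ | ⟨γ, hγ, h, _⟩)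
    · linarith
    · have := hM γ hγ; linarith
  ext y
  have := hpow n y
  rw [hbot, Submodule.mem_bot] at this
  rw [this]; rfl

end Lie

theorem exists_functional {V : Type*} [NormedAddCommGroup V] [InnerProductSpace ℝ V]
    (D : RootSystemData V) {α β : V} (hα : α ∈ D.pos) (hβ : β ∈ D.pos)
    (hneg : ⟪α, β⟫ < 0) : ∃ v : V, 1 ≤ ⟪v, α⟫ ∧ 1 ≤ ⟪v, β⟫ := by
  have hcs := strict_cs D hα hβ hneg
  have ha : 0 < ‖α‖ := norm_pos_iff.2 (D.ne_zero α (D.pos_subset hα))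
  have hb : 0 < ‖β‖ := norm_pos_iff.2 (D.ne_zero β (D.pos_subset hβ))
  set w : V := ‖β‖ • α + ‖α‖ • β with hw
  have w1 : 0 < ⟪w, α⟫ := by
    rw [hw, inner_add_left, real_inner_smul_left, real_inner_smul_left, real_inner_comm,
      real_inner_self_eq_norm_sq, real_inner_comm]
    have := mul_pos ha (by linarith : 0 < ‖α‖ * ‖β‖ + ⟪α, β⟫)
    rw [real_inner_comm] at this ⊢
    nlinarith
  have w2 : 0 < ⟪w, β⟫ := by
    rw [hw, inner_add_left, real_inner_smul_left, real_inner_smul_left,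
      real_inner_self_eq_norm_sq]
    have := mul_pos hb (by linarith : 0 < ‖α‖ * ‖β‖ + ⟪α, β⟫)
    nlinarith
  refine ⟨(⟪w, α⟫⁻¹ + ⟪w, β⟫⁻¹) • w, ?_, ?_⟩
  · rw [real_inner_smul_left, add_mul, inv_mul_cancel₀ w1.ne']
    have : 0 ≤ ⟪w, β⟫⁻¹ * ⟪w, α⟫ := by positivity
    linarith
  · rw [real_inner_smul_left, add_mul, inv_mul_cancel₀ w2.ne']
    have : 0 ≤ ⟪w, α⟫⁻¹ * ⟪w, β⟫ := by positivity
    linarith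

end Helpers

/-- Suppose `Φ` is irreducible and not of type `G₂`. If
`α, β ∈ Φ⁺` satisfy `⟨α, β⟩ < 0` and `e_α ∈ 𝔤_α`, `e_β ∈ 𝔤_β` are nonzero, then
`ad(e_α + e_β)^4 ≠ 0`; in particular `e_α + e_β` has height at least `4`. -/
theorem ad_pow_four_ne_zero_of_pairing_neg
    {V : Type*} [NormedAddCommGroup V] [InnerProductSpace ℝ V]
    {L : Type*} [LieRing L] [LieAlgebra ℂ L]
    (D : LieRootData V L)
    (hirr : D.toRootSystemData.IsIrreducible)
    (hG2 : D.toRootSystemData.NotG2)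
    (α β : V) (hα : α ∈ D.pos) (hβ : β ∈ D.pos) (hneg : cpair α β < 0)
    (e f : L) (he : e ∈ D.rs α) (he0 : e ≠ 0) (hf : f ∈ D.rs β) (hf0 : f ≠ 0) :
    (LieAlgebra.ad ℂ L (e + f)) ^ 4 ≠ 0 ∧ 4 ≤ heightOf (e + f) := by
  have hαr := D.pos_subset hα
  have hβr := D.pos_subset hβ
  have hin : ⟪α, β⟫ < 0 := by
    have hb := inner_pos_of_root D.toRootSystemData hβr
    unfold cpair at hneg
    by_contra h
    push Not at h
    have : 0 ≤ 2 * ⟪α, β⟫ / ⟪β, β⟫ := by positivity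
    linarith
  have key : ∃ x : L, ⁅e + f, ⁅e + f, ⁅e + f, ⁅e + f, x⁆⁆⁆⁆ ≠ 0 := by
    rcases pairing_cases D.toRootSystemData hG2 hα hβ hin with ⟨hm, hn⟩ | ⟨hm, hn⟩ | ⟨hm, hn⟩
    · exact case_A2 D hG2 hαr hβr hm hn he he0 hf hf0
    · exact case_B2 D hG2 hαr hβr hm hn he he0 hf hf0
    · rw [add_comm e f]
      exact case_B2 D hG2 hβr hαr hn hm hf hf0 he he0
  have h4 : (LieAlgebra.ad ℂ L (e + f)) ^ 4 ≠ 0 := by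
    obtain ⟨x, hx⟩ := key
    intro h
    apply hx
    have := LinearMap.congr_fun h x
    simpa only [pow_succ, pow_zero, one_mul, Module.End.mul_apply, LieAlgebra.ad_apply,
      LinearMap.zero_apply] using this
  refine ⟨h4, ?_⟩
  obtain ⟨v, h1, h2⟩ := exists_functional D.toRootSystemData hα hβ hin
  obtain ⟨N, hN⟩ := nilp D v hαr hβr h1 h2 he hf
  refine le_csSup ⟨N, fun n hn => ?_⟩ h4
  by_contra h
  exact hn (hN n (by omega))
end
end
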